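/- arXiv:2509.16514 — 5 statements merged into one kernel-verified Lean document; each statement's English description precedes it below -/
import Mathlib

section
/- For all integers n ≥ 1 and 0 ≤ m ≤ C(n,2), the class 𝒢_{n,m} of simple graphs on n vertices with m edges contains an H-optimal graph, and any two H-optimal graphs in 𝒢_{n,m} are isomorphic. -/
noncomputable def edgeCount {V : Type} (G : SimpleGraph V) : ℕ := G.edgeSet.ncard

noncomputable def M1 {V : Type} [Fintype V] (G : SimpleGraph V) : ℕ :=
  ∑ v : V, (G.neighborSet v).ncard ^ 2

open Classical in
/-- Second Zagreb index: each unordered edge counted once (ordered sum halved). -/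
noncomputable def M2 {V : Type} [Fintype V] (G : SimpleGraph V) : ℕ :=
  (∑ u : V, ∑ v : V,
    if G.Adj u v then (G.neighborSet u).ncard * (G.neighborSet v).ncard else 0) / 2

noncomputable def k3 {V : Type} [Fintype V] (G : SimpleGraph V) : ℕ :=
  {s : Finset V | G.IsNClique 3 s}.ncard

noncomputable def Hval {V : Type} [Fintype V] (G : SimpleGraph V) : ℤ :=
  (M2 G : ℤ) - 6 * (k3 G : ℤ)

/-- `G` is M-optimal among simple graphs on `V` with `m` edges. -/
def MOptimal {V : Type} [Fintype V] (m : ℕ) (G : SimpleGraph V) : Prop :=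
  edgeCount G = m ∧ ∀ G' : SimpleGraph V, edgeCount G' = m → M1 G' ≤ M1 G

/-- `G` is H-optimal among simple graphs on `V` with `m` edges. -/
def HOptimal {V : Type} [Fintype V] (m : ℕ) (G : SimpleGraph V) : Prop :=
  MOptimal m G ∧ ∀ G' : SimpleGraph V, MOptimal m G' → Hval G' ≤ Hval G

/-- A two-terminal graph on `n` labeled vertices. -/
structure TwoTerminalGraph (n : ℕ) where
  graph : SimpleGraph (Fin n)
  s : Fin n
  t : Fin n
  hst : s ≠ t

/-- The set of two-terminal graphs on `n` vertices with `m` edges. -/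
def TT (n m : ℕ) : Set (TwoTerminalGraph n) := {G | edgeCount G.graph = m}

/-- `Ncoeff G i` = number of `i`-edge subsets `F` of `E(G)` such that the terminals
are joined by a path in the spanning subgraph `(V, F)`. -/
noncomputable def Ncoeff {n : ℕ} (G : TwoTerminalGraph n) (i : ℕ) : ℕ :=
  {F : Set (Sym2 (Fin n)) | F ⊆ G.graph.edgeSet ∧ F.ncard = i ∧
    (SimpleGraph.fromEdgeSet F).Reachable G.s G.t}.ncard

/-- Two-terminal reliability at `p`, for a graph with `m` edges. -/
noncomputable def relia {n : ℕ} (m : ℕ) (G : TwoTerminalGraph n) (p : ℝ) : ℝ :=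
  ∑ i ∈ Finset.Icc 1 m, (Ncoeff G i : ℝ) * p ^ i * (1 - p) ^ (m - i)

/-- Locally most reliable two-terminal graph in `TT n m`. -/
def IsLMRTTG (n m : ℕ) (G : TwoTerminalGraph n) : Prop :=
  G ∈ TT n m ∧ ∀ H ∈ TT n m, ∃ δ > 0, ∀ p ∈ Set.Ioo (0:ℝ) δ, relia m H p ≤ relia m G p

/-- Isomorphism of two-terminal graphs: a graph isomorphism mapping terminals to terminals. -/
def TTIso {n : ℕ} (G H : TwoTerminalGraph n) : Prop :=
  ∃ e : G.graph ≃g H.graph, (e G.s = H.s ∧ e G.t = H.t) ∨ (e G.s = H.t ∧ e G.t = H.s)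

/-- The iterated maximizing subsets `T_{n,m}^{(i)}`. -/
def TTfilter (n m : ℕ) : ℕ → Set (TwoTerminalGraph n)
  | 0 => TT n m
  | i + 1 => {G ∈ TTfilter n m i | ∀ H ∈ TTfilter n m i, Ncoeff H (i+1) ≤ Ncoeff G (i+1)}

/-- The quasi-complete graph `C¹_{n,m}` with parameters `k, j`
(`m = C(k+1,2) − j`, `1 ≤ j ≤ k`): a `K_k` on vertices `0..k-1`, one extra vertex `k`
adjacent to exactly `k−j` vertices of the clique, and `n−k−1` isolated vertices. -/
def quasiComplete (n k j : ℕ) : SimpleGraph (Fin n) :=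
  SimpleGraph.fromRel (fun a b => (a.val < k ∧ b.val < k) ∨ (a.val = k ∧ b.val < k - j))

/-- The quasi-star graph `S¹_{n,m}` with parameters `k', j'`
(`m = C(n,2) − C(k'+1,2) + j'`): the complement of the quasi-complete graph,
i.e. `K_{n−k'−1} ∨ ((K_1 ∨ j'K_1) ∪ (k'−j')K_1)`. -/
def quasiStar (n k' j' : ℕ) : SimpleGraph (Fin n) := (quasiComplete n k' j')ᶜ

/-- `S²_{n,m} = K_{n−2k'+j'} ∨ ((K_{k'−j'} ∨ (k'−1)K_1) ∪ K_1)`. -/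
def quasiStar2 (n k' j' : ℕ) : SimpleGraph (Fin n) :=
  SimpleGraph.fromRel (fun x y =>
    x.val < n - 2*k' + j' ∨
    (n - 2*k' + j' ≤ x.val ∧ x.val < n - k' ∧ n - 2*k' + j' ≤ y.val ∧ y.val < n - k') ∨
    (n - 2*k' + j' ≤ x.val ∧ x.val < n - k' ∧ n - k' ≤ y.val ∧ y.val < n - 1))

/-- `S³_{n,m} = K_{n−k'−1} ∨ (K_3 ∪ (k'−2)K_1)` (defined when `j' = 3`). -/
def quasiStar3 (n k' : ℕ) : SimpleGraph (Fin n) :=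
  SimpleGraph.fromRel (fun x y =>
    x.val < n - k' - 1 ∨
    (n - k' - 1 ≤ x.val ∧ x.val < n - k' + 2 ∧ n - k' - 1 ≤ y.val ∧ y.val < n - k' + 2))

/-- `C³_{n,m} = (K_{k−2} ∨ 3K_1) ∪ (n−k−1)K_1` (defined when `j = 3`). -/
def quasiComplete3 (n k : ℕ) : SimpleGraph (Fin n) :=
  SimpleGraph.fromRel (fun x y =>
    (x.val < k - 2 ∧ y.val < k - 2) ∨ (x.val < k - 2 ∧ k - 2 ≤ y.val ∧ y.val < k + 1))

noncomputable def pPoly (x : ℝ) : ℝ :=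
  (1/8) * ((3 - 2*Real.sqrt 2)*x^4 - (20 + 37*Real.sqrt 2)*x^3
    + (19 + 76*Real.sqrt 2)*x^2 - (46 + 226*Real.sqrt 2)*x + 72)

noncomputable def qPoly (x : ℝ) : ℝ :=
  (1/8) * (2*Real.sqrt 2*x^3 - 2*x^2 - 16*Real.sqrt 2*x + 4)

/-- The family `S^i_{n,m}` for `i ∈ {1,2,3}`. -/
def Sfam (n k' j' : ℕ) : ℕ → SimpleGraph (Fin n)
  | 1 => quasiStar n k' j'
  | 2 => quasiStar2 n k' j'
  | 3 => quasiStar3 n k'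
  | _ => ⊥

/-- Existence conditions for `S^i_{n,m}`, `i ∈ {1,2,3}`. -/
def SExists (n k' j' : ℕ) : ℕ → Prop
  | 1 => True
  | 2 => k' + 1 ≤ 2*k' - j' - 1 ∧ 2*k' - j' - 1 ≤ n - 1
  | 3 => j' = 3
  | _ => False


/-- word encoding of threshold graphs -/
def wm : List Bool → ℤ
  | [] => 0
  | true :: w => wm w + (w.length + 1)
  | false :: w => wm w
def wM : List Bool → ℤ
  | [] => 0
  | true :: w => wM w + ((w.length + 1)^2 + (w.length + 1) + 4 * wm w)
  | false :: w => wM w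
def wH : List Bool → ℤ
  | [] => 0
  | true :: w => wH w + (wM w + (2 * (w.length + 1) - 5) * wm w + (w.length + 1)^2)
  | false :: w => wH w

abbrev wD (a : ℕ) : List Bool := List.replicate a true
abbrev wI (a : ℕ) : List Bool := List.replicate a false

def WOpt (w : List Bool) : Prop :=
  ∀ v : List Bool, v.length = w.length → wm v = wm w → wM v ≤ wM w

theorem wm_I (a : ℕ) (w : List Bool) : wm (wI a ++ w) = wm w := by
  induction a with
  | zero => simp
  | succ a ih => simpa [wI, List.replicate_succ, wm] using ih
theorem wM_I (a : ℕ) (w : List Bool) : wM (wI a ++ w) = wM w := by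
  induction a with
  | zero => simp
  | succ a ih => simpa [wI, List.replicate_succ, wM] using ih
theorem wH_I (a : ℕ) (w : List Bool) : wH (wI a ++ w) = wH w := by
  induction a with
  | zero => simp
  | succ a ih => simpa [wI, List.replicate_succ, wH] using ih

theorem wE (e : ℕ) : 2 * wm (wD e) = e * (e + 1) ∧ wM (wD e) = (e + 1) * e^2 ∧
    2 * wH (wD e) = e * (e + 1) * ((e - 1)^2 + 1) := by
  induction e with
  | zero => simp [wm, wM, wH]
  | succ e ih =>
    obtain ⟨h1, h2, h3⟩ := ih
    simp only [wD, List.replicate_succ, wm, wM, wH, List.length_replicate] at *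
    push_cast
    refine ⟨by linear_combination h1, by linear_combination h2 + 2 * h1, ?_⟩
    linear_combination h3 + 2 * h2 + (2 * (e + 1) - 5 : ℤ) * h1

abbrev wP (b e : ℕ) : List Bool := wD b ++ false :: wD e

theorem wP_len (b e : ℕ) : (wP b e).length = b + e + 1 := by simp; ring

theorem wP_num (b e : ℕ) :
    2 * wm (wP b e) = (b + e + 1) * (b + e) + 2 * b ∧
    wM (wP b e) = (b + e + 1) * (b + e)^2 + b * (2 * (b + e + 1) - 1) + b^2 ∧
    2 * wH (wP b e) = (b + e + 1) * (b + e) * ((b + e + 1)^2 - 4 * (b + e + 1) + 5)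
      + 2 * b * (b + e + 1) * (b + e) + (2 * (b + e + 1) - 7) * (b^2 - b) + 2 * b^2 := by
  induction b with
  | zero =>
    obtain ⟨h1, h2, h3⟩ := wE e
    simp only [wP, wD, List.replicate_zero, List.nil_append, wm, wM, wH] at *
    push_cast
    exact ⟨by linear_combination h1, by linear_combination h2, by linear_combination h3⟩
  | succ b ih =>
    obtain ⟨h1, h2, h3⟩ := ih
    have hl := wP_len b e
    simp only [wP, wD, List.replicate_succ, List.cons_append, wm, wM, wH] at *
    rw [hl]
    push_cast
    refine ⟨by linear_combination h1, by linear_combination h2 + 2 * h1, ?_⟩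
    linear_combination h3 + 2 * h2 + (2 * (b + e + 2) - 5 : ℤ) * h1

/-- a word with a star on top -/
theorem w_top (g : ℕ) (w : List Bool) :
    wm (true :: (wI g ++ w)) = wm w + (g + w.length + 1) ∧
    wM (true :: (wI g ++ w)) = wM w + ((g + w.length + 1)^2 + (g + w.length + 1) + 4 * wm w) ∧
    wH (true :: (wI g ++ w)) = wH w + (wM w + (2 * (g + w.length + 1) - 5) * wm w
      + (g + w.length + 1)^2) := by
  simp only [wm, wM, wH, wm_I, wM_I, wH_I, List.length_append, List.length_replicate]
  push_cast
  simp

theorem wopt_tail {x : Bool} {w : List Bool} (h : WOpt (x :: w)) : WOpt w := by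
  intro v hv hm
  have := h (x :: v) (by simp [hv])
  cases x <;> simp [wm, wM, hv, hm] at this <;> exact this

theorem wopt_pad {a : ℕ} {w : List Bool} (h : WOpt (wI a ++ w)) : WOpt w := by
  induction a with
  | zero => simpa using h
  | succ a ih => exact ih (wopt_tail (x := false) (by simpa [wI, List.replicate_succ] using h))

theorem wopt_no {w v : List Bool} (h : WOpt w) (hl : v.length = w.length) (hm : wm v = wm w)
    (hM : wM w < wM v) : False := absurd (h v hl hm) (not_le.mpr hM)

theorem lt_gap {x y : ℤ} (g : ℤ) (hg : 0 < g) (h : y - x = g) : x < y := by linarith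

/-- L1 -/
theorem L1 (s b e : ℕ) (hk : 4 ≤ b + e + 1 ∨ (3 ≤ b + e + 1 ∧ 1 ≤ b)) (hs : b + e + 1 ≤ s + 1)
    (h : WOpt (wI s ++ wP b e)) : False := by
  rcases Nat.eq_zero_or_pos b with rfl | hb
  · have he : 3 ≤ e := by omega
    obtain ⟨t, rfl⟩ := Nat.exists_eq_add_of_le he
    obtain ⟨p, rfl⟩ := Nat.exists_eq_add_of_le (show t + 2 ≤ s by omega)
    have hp := wP_num t 0
    have hq := wP_num 0 (3 + t)
    have ht := w_top (t + 4) (wP t 0)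
    rw [wP_len] at ht
    push_cast at *
    refine wopt_no h (v := wI p ++ true :: (wI (t + 4) ++ wP t 0)) ?_ ?_ ?_
    · simp; ring
    · rw [wm_I, wm_I, ht.1]; linarith [hp.1, hq.1]
    · rw [wM_I, wM_I, ht.2.1]; exact lt_gap (6) (by positivity) (by linear_combination hp.2.1 - hq.2.1 + 2 * hp.1)
  · obtain ⟨b, rfl⟩ := Nat.exists_eq_add_of_le hb
    rcases Nat.eq_zero_or_pos e with rfl | he
    · obtain ⟨t, rfl⟩ := Nat.exists_eq_add_of_le (show 1 ≤ b by omega)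
      obtain ⟨p, rfl⟩ := Nat.exists_eq_add_of_le (show t + 2 ≤ s by omega)
      have hp := wP_num t 0
      have hq := wP_num (1 + (1 + t)) 0
      have ht := w_top (t + 3) (wP t 0)
      rw [wP_len] at ht
      push_cast at *
      refine wopt_no h (v := wI p ++ true :: (wI (t + 3) ++ wP t 0)) ?_ ?_ ?_
      · simp; ring
      · rw [wm_I, wm_I, ht.1]; linarith [hp.1, hq.1]
      · rw [wM_I, wM_I, ht.2.1]; exact lt_gap (4) (by positivity) (by linear_combination hp.2.1 - hq.2.1 + 2 * hp.1)
    · obtain ⟨e, rfl⟩ := Nat.exists_eq_add_of_le he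
      obtain ⟨p, rfl⟩ := Nat.exists_eq_add_of_le (show b + e + 1 ≤ s by omega)
      have hp := wP_num b e
      have hq := wP_num (1 + b) (1 + e)
      have ht := w_top (b + e + 2) (wP b e)
      rw [wP_len] at ht
      push_cast at *
      refine wopt_no h (v := wI p ++ true :: (wI (b + e + 2) ++ wP b e)) ?_ ?_ ?_
      · simp; ring
      · rw [wm_I, wm_I, ht.1]; linarith [hp.1, hq.1]
      · rw [wM_I, wM_I, ht.2.1]; exact lt_gap (2 * (1 + e)) (by positivity) (by linear_combination hp.2.1 - hq.2.1 + 2 * hp.1)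

/-- L2 -/
theorem L2 (s b e : ℕ) (hk : 3 ≤ b + e + 1) (hb : 1 ≤ b) (hs : 1 ≤ s)
    (h : WOpt (true :: (wI s ++ wP b e))) : False := by
  by_cases h1 : b + e + 1 ≤ s + 1
  · exact L1 s b e (Or.inr ⟨hk, hb⟩) h1 (wopt_tail h)
  have hq := wP_num b e
  have ht := w_top s (wP b e)
  rw [wP_len] at ht
  push_cast at ht
  by_cases h2 : s + b ≤ b + e
  · obtain ⟨p, rfl⟩ := Nat.exists_eq_add_of_le (show s ≤ e by omega)
    have hp := wP_num (s + b + 1) p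
    push_cast at *
    refine wopt_no h (v := wI s ++ wP (s + b + 1) p) ?_ ?_ ?_
    · simp; ring
    · rw [wm_I, ht.1]; linarith [hp.1, hq.1]
    · have hs' : (0 : ℤ) < s := by exact_mod_cast hs
      have hb' : (0 : ℤ) < b := by exact_mod_cast hb
      rw [wM_I, ht.2.1]
      exact lt_gap (2 * b * s) (by positivity) (by linear_combination hp.2.1 - hq.2.1 - 2 * hq.1)
  · obtain ⟨z, rfl⟩ := Nat.exists_eq_add_of_le (show e + 1 ≤ s by omega)
    obtain ⟨p, rfl⟩ := Nat.exists_eq_add_of_le (show z + 1 ≤ b by omega)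
    have hp := wP_num z (e + p + 3)
    push_cast at *
    refine wopt_no h (v := wI (e + z) ++ wP z (e + p + 3)) ?_ ?_ ?_
    · simp; ring
    · rw [wm_I, ht.1]; linarith [hp.1, hq.1]
    · rw [wM_I, ht.2.1]
      exact lt_gap (2 * (e + 1) * (p + 1)) (by positivity)
        (by linear_combination hp.2.1 - hq.2.1 - 2 * hq.1)


def nlT (n k q b c : ℕ) : Bool :=
  !(Nat.beq ((k * (k - 1) + 2 * b) * (n - k) + c * (c + 1)) ((q * (q - 1) + 2 * c) * (n - q) + b * (b + 1)))
  || (Nat.blt (2 * b * (k - b) * (k - 3) + 2 * (n - q) * c^2 + 2 * (n - q) * c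
        + 2 * (q * (q - 1) + 2 * c) * (n - q))
      ((q * (q - 1) + 2 * c) * (n - q)^2 + c * (2 * q + 3) + c^2) &&
     (Nat.blt c 2 || Nat.blt n (q + c) || 
      Nat.blt (2 * b * (k - b) * (k - 3) + 2 * (n - q) * c^2 + 2 * (n - q) * c
        + 2 * (q * (q - 1) + 2 * c) * (n - q) + (2 * q - 7) * c * (c - 1))
      ((q * (q - 1) + 2 * c) * (n - q)^2 + c * (2 * q + 3) + c^2)))

def nlQ (n k q s : ℕ) : Bool :=
  Nat.ble (k + q) s || (List.range k).all fun b => Nat.blt s b || nlT n k q b (s - b)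

def nlF : Bool := (List.range 57).all fun n => Nat.blt n 8 || (List.range n).all fun k =>
  Nat.ble (2 * k) n || (List.range n).all fun q =>
  Nat.ble (2 * q) n || Nat.blt (n * (n - 1)) (k * (k - 1) + q * (q - 1)) ||
    nlQ n k q ((n * (n - 1) - (k * (k - 1) + q * (q - 1))) / 2)

theorem nlF_true : nlF = true := by decide +kernel

set_option maxHeartbeats 1000000 in
theorem NLinf (n k b q c : ℤ) (hn : 57 ≤ n) (hb : 0 ≤ b) (hbk : b < k) (hc : 0 ≤ c) (hcq : c < q)
    (hk : k < n) (hq : q < n) (hk2 : n + 1 ≤ 2 * k) (hq2 : n + 1 ≤ 2 * q)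
    (hm : k * (k - 1) + 2 * b + (q * (q - 1) + 2 * c) = n * (n - 1)) :
    0 < (q * (q - 1) + 2 * c) * (n - q) * (n - q - 2) - 2 * b * (k - b) * (k - 3)
      - (2 * (n - q) - 1) * c^2 + c * (2 * q - 2 * (n - q) + 3) ∧
    (2 ≤ c → q + c ≤ n → (2 * q - 7) * c * (c - 1) <
      (q * (q - 1) + 2 * c) * (n - q) * (n - q - 2) - 2 * b * (k - b) * (k - 3)
      - (2 * (n - q) - 1) * c^2 + c * (2 * q - 2 * (n - q) + 3)) := by
  obtain ⟨p, rfl⟩ : ∃ p, n = q + p := ⟨n - q, by ring⟩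
  have hpq : q + p - q = p := by ring
  rw [hpq]
  have hp0 : 0 < p := by linarith
  have hkk : k * (k - 1) ≤ p * (2 * q + p - 1) := by nlinarith
  have hkk2 : (q + p + 1) * (q + p - 1) ≤ 4 * (k * (k - 1)) := by
    nlinarith [mul_nonneg (show 0 ≤ 2 * k - (q + p + 1) by linarith) (show 0 ≤ 2 * k + (q + p) - 1 by linarith)]
  have h8 : q + p ≤ 8 * p := by
    by_contra hcon
    have : 8 * p + 1 ≤ q + p := by linarith
    nlinarith [mul_nonneg (show 0 ≤ q + p - (8 * p + 1) by linarith) (show 0 ≤ q + p by linarith)]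
  have hp8 : 8 ≤ p := by linarith
  have hqp : p + 1 ≤ q := by linarith
  have hB : 4 * b * (k - b) * (k - 3) ≤ p * ((q + p) * (2 * q + p)) := by
    have h1 : 4 * b * (k - b) ≤ k^2 := by nlinarith [sq_nonneg (k - 2 * b)]
    calc 4 * b * (k - b) * (k - 3) ≤ k^2 * (k - 3) :=
          mul_le_mul_of_nonneg_right h1 (by linarith)
      _ ≤ k * (k * (k - 1)) := by nlinarith [sq_nonneg k]
      _ ≤ k * (p * (2 * q + p - 1)) := mul_le_mul_of_nonneg_left hkk (by linarith)
      _ ≤ (q + p) * (p * (2 * q + p - 1)) :=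
          mul_le_mul_of_nonneg_right hk.le (mul_nonneg hp0.le (by linarith))
      _ ≤ p * ((q + p) * (2 * q + p)) := by
          nlinarith [mul_nonneg hp0.le (show 0 ≤ q + p by linarith)]
  have hpp : 0 ≤ 2 * p * (p - 2) - 2 * p + 3 := by nlinarith
  have hn2 : (q + p) * (2 * q + p) ≤ 6 * q^2 := by nlinarith
  constructor
  · have hC : -(2 * p - 3) * q * q ≤ 2 * c * p * (p - 2) - (2 * p - 1) * c^2 + c * (2 * q - 2 * p + 3) := by
      have e1 : 0 ≤ c * (2 * p * (p - 2) - 2 * p + 3) := mul_nonneg hc hpp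
      have e2 : 0 ≤ (2 * p - 1) * (c * (q - c)) :=
        mul_nonneg (by linarith) (mul_nonneg hc (by linarith))
      have e3 : 0 ≤ (2 * p - 3) * (q * (q - c)) :=
        mul_nonneg (by linarith) (mul_nonneg (by linarith) (by linarith))
      linarith
    have hm1 : p * (10 * q^2) < p * (2 * (q * (q - 1)) * (p - 2)) := by
      apply mul_lt_mul_of_pos_left _ hp0
      have : 0 ≤ (q * (q - 1)) * (p - 8) := mul_nonneg (mul_nonneg (by linarith) (by linarith)) (by linarith)
      have h7 : 0 < q * (q - 6) := mul_pos (by linarith) (by linarith)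
      linarith
    have hm2 : p * ((q + p) * (2 * q + p)) ≤ p * (6 * q^2) := mul_le_mul_of_nonneg_left hn2 hp0.le
    ring_nf at hC hB hm1 hm2 ⊢
    linarith [sq_nonneg q]
  · intro hc2 hcp
    have hcp' : c ≤ p := by linarith
    have hcc : c^2 ≤ p^2 := pow_le_pow_left₀ hc hcp' 2
    have hcc2 : 2 * (q + p) * c^2 ≤ 2 * (q + p) * p^2 :=
      mul_le_mul_of_nonneg_left hcc (by linarith)
    have e1 : 0 ≤ c * (2 * p * (p - 2) - 2 * p + 3) := mul_nonneg hc hpp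
    have e4 : 0 ≤ c * (4 * q - 7) := mul_nonneg hc (by linarith)
    have hm2 : p * ((q + p) * (2 * q + p)) ≤ p * (6 * q^2) := mul_le_mul_of_nonneg_left hn2 hp0.le
    have hm1 : p * (6 * q^2 + 4 * (q + p) * p) < p * (2 * (q * (q - 1)) * (p - 2)) := by
      apply mul_lt_mul_of_pos_left _ hp0
      have h5 : 4 * (q + p) * p ≤ 8 * q * p := by nlinarith
      have h6 : 0 < q * (2 * ((q - 5) * (p - 5)) - 46) := by
        apply mul_pos (by linarith)
        have := mul_le_mul (show (24:ℤ) ≤ q - 5 by linarith) (show (3:ℤ) ≤ p - 5 by linarith) (by norm_num) (by linarith)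
        linarith
      linarith
    ring_nf at hB hcc2 e1 e4 hm1 hm2 ⊢
    linarith [sq_nonneg c]

theorem NL (n k b q c : ℕ) (hn : 8 ≤ n) (hbk : b < k) (hcq : c < q)
    (hk : k < n) (hq : q < n) (hk2 : n + 1 ≤ 2 * k) (hq2 : n + 1 ≤ 2 * q)
    (hm : (k : ℤ) * (k - 1) + 2 * b + (q * (q - 1) + 2 * c) = n * (n - 1))
    (ht : ((k : ℤ) * (k - 1) + 2 * b) * (n - k) + c * (c + 1)
      = (q * (q - 1) + 2 * c) * (n - q) + b * (b + 1)) :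
    (0 : ℤ) < (q * (q - 1) + 2 * c) * (n - q) * (n - q - 2) - 2 * b * (k - b) * (k - 3)
      - (2 * (n - q) - 1) * c^2 + c * (2 * q - 2 * (n - q) + 3) ∧
    (2 ≤ c → q + c ≤ n → (2 * q - 7) * c * (c - 1) <
      ((q : ℤ) * (q - 1) + 2 * c) * (n - q) * (n - q - 2) - 2 * b * (k - b) * (k - 3)
      - (2 * (n - q) - 1) * c^2 + c * (2 * q - 2 * (n - q) + 3)) := by
  by_cases hbig : 57 ≤ n
  · have := NLinf n k b q c (by exact_mod_cast hbig) (by positivity) (by exact_mod_cast hbk)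
      (by positivity) (by exact_mod_cast hcq) (by exact_mod_cast hk) (by exact_mod_cast hq)
      (by exact_mod_cast hk2) (by exact_mod_cast hq2) hm
    exact ⟨this.1, fun h1 h2 => this.2 (by exact_mod_cast h1) (by exact_mod_cast h2)⟩
  · have hF := nlF_true
    simp only [nlF, List.all_eq_true, List.mem_range, Bool.or_eq_true, Nat.blt, Nat.ble_eq] at hF
    obtain ⟨P, rfl⟩ := Nat.exists_eq_add_of_lt hq
    obtain ⟨R, hR⟩ := Nat.exists_eq_add_of_lt hk
    obtain ⟨k', rfl⟩ := Nat.exists_eq_add_of_le (show 4 ≤ k by omega)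
    obtain ⟨q', rfl⟩ := Nat.exists_eq_add_of_le (show 4 ≤ q by omega)
    obtain ⟨B, hB⟩ := Nat.exists_eq_add_of_lt hbk
    have e : (4 + k') * (4 + k' - 1) + 2 * b + ((4 + q') * (4 + q' - 1) + 2 * c)
        = (4 + q' + P + 1) * (4 + q' + P + 1 - 1) := by
      have e1 : 4 + k' - 1 = k' + 3 := by omega
      have e2 : 4 + q' - 1 = q' + 3 := by omega
      have e3 : 4 + q' + P + 1 - 1 = 4 + q' + P := by omega
      rw [e1, e2, e3]
      zify
      push_cast at hm
      linear_combination hm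
    have h := ((hF _ (by omega)).resolve_left (by omega) _ hk).resolve_left (by omega) _ hq
    have h := (h.resolve_left (by omega))
    have hs : ((4 + q' + P + 1) * (4 + q' + P + 1 - 1) -
        ((4 + k') * (4 + k' - 1) + (4 + q') * (4 + q' - 1))) / 2 = b + c := by omega
    rw [hs] at h
    simp only [nlQ, List.all_eq_true, List.mem_range, Bool.or_eq_true, Nat.blt, Nat.ble_eq] at h
    have h := ((h.resolve_left (by omega)) b hbk).resolve_left (by omega)
    rw [Nat.add_sub_cancel_left] at h
    have e1 : 4 + k' - 1 = k' + 3 := by omega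
    have e2 : 4 + q' - 1 = q' + 3 := by omega
    have e3 : 4 + q' + P + 1 - (4 + q') = P + 1 := by omega
    have e4 : 4 + q' + P + 1 - (4 + k') = R + 1 := by omega
    have e5 : 4 + k' - b = B + 1 := by omega
    have e6 : 4 + k' - 3 = k' + 1 := by omega
    have e7 : 2 * (4 + q') - 7 = 2 * q' + 1 := by omega
    simp only [nlT, Bool.or_eq_true, Bool.and_eq_true, Nat.blt, Nat.ble_eq, Bool.not_eq_true',
      e1, e2, e3, e4, e5, e6, e7] at h
    have hR' : (q' : ℤ) + P = k' + R := by push_cast at hR; omega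
    have hB' : (k' : ℤ) = b + B - 3 := by omega
    have hP' : (P : ℤ) = k' + R - q' := by omega
    have h := h.resolve_left (by
      rw [Bool.not_eq_false, Nat.beq_eq]
      zify
      push_cast at ht
      rw [hP'] at *
      linear_combination ht)
    obtain ⟨h1, h2⟩ := h
    constructor
    · zify at h1
      push_cast
      have : (4 + k' - b : ℤ) = B + 1 := by omega
      rw [this]
      linarith
    · intro hc1 hc2
      have h2 := (h2.resolve_left (by omega))
      obtain ⟨C, rfl⟩ := Nat.exists_eq_add_of_le hc1
      have e8 : 2 + C - 1 = C + 1 := by omega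
      rw [e8] at h2
      zify at h2
      push_cast
      have : (4 + k' - b : ℤ) = B + 1 := by omega
      rw [this]
      linarith


/-- complement word -/
def wc (w : List Bool) : List Bool := w.map not

theorem wc_cons (x : Bool) (w : List Bool) : wc (x :: w) = (!x) :: wc w := rfl
@[simp] theorem wc_len (w : List Bool) : (wc w).length = w.length := by simp [wc]
@[simp] theorem wc_wc (w : List Bool) : wc (wc w) = w := by
  induction w with
  | nil => rfl
  | cons x w ih => simp [wc_cons, ih]
theorem wc_app (v w : List Bool) : wc (v ++ w) = wc v ++ wc w := by simp [wc]
theorem wc_D (a : ℕ) : wc (wD a) = wI a := by simp [wc]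
theorem wc_I (a : ℕ) : wc (wI a) = wD a := by simp [wc]

theorem wc_num (w : List Bool) :
    2 * wm (wc w) = (w.length + 1) * w.length - 2 * wm w ∧
    wM (wc w) = (w.length + 1) * w.length^2 - 4 * w.length * wm w + wM w ∧
    2 * wH (wc w) + 2 * wH w = ((w.length + 1) * w.length - 2 * wm w)^2
      - (w.length + 1) * w.length^2 - 2 * ((w.length + 1) * w.length) * (w.length - 1)
      + 16 * wm w * w.length - 2 * wm w * w.length^2 + (2 * w.length - 7) * wM w := by
  induction w with
  | nil => simp [wc, wm, wM, wH]
  | cons x w ih =>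
    obtain ⟨h1, h2, h3⟩ := ih
    cases x
    · simp only [wc_cons, Bool.not_false, wm, wM, wH, wc_len, List.length_cons]
      push_cast
      refine ⟨by linear_combination h1, by linear_combination h2 + 2 * h1, ?_⟩
      linear_combination h3 + 2 * h2 + (2 * (w.length + 1) - 5 : ℤ) * h1
    · simp only [wc_cons, Bool.not_true, wm, wM, wH, wc_len, List.length_cons]
      push_cast
      refine ⟨by linear_combination h1, by linear_combination h2, ?_⟩
      linear_combination h3
  
theorem wopt_c {w : List Bool} (h : WOpt w) : WOpt (wc w) := by
  intro v hv hm
  have hv' : v.length = w.length := by simpa using hv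
  have h1 := wc_num w
  have h2 := wc_num v
  rw [hv'] at h2
  have hmm : wm (wc v) = wm w := by linarith [h1.1, h2.1]
  have := h (wc v) (by simp [hv']) hmm
  have e : wm v = wm (wc w) := hm
  have e2 : 2 * wm v = (w.length + 1) * w.length - 2 * wm w := by linarith [h1.1]
  rw [h2.2.1] at this
  rw [h1.2.1]
  have : wM v ≤ wM w - ((w.length + 1) * w.length^2 - 4 * w.length * wm v) := by linarith
  have e3 : 2 * w.length * (2 * wm v) = 2 * w.length * ((w.length + 1) * w.length - 2 * wm w) := by
    rw [e2]
  linarith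

set_option linter.unusedSimpArgs false

theorem wopt_congr {w v : List Bool} (h : WOpt w) (hl : v.length = w.length) (hm : wm v = wm w)
    (hM : wM v = wM w) : WOpt v := by
  intro u hu hum
  rw [hM]
  exact h u (hu.trans hl) (hum.trans hm)

theorem wI_succ (s : ℕ) (w : List Bool) : false :: (wI s ++ w) = wI (s + 1) ++ w := by
  simp [List.replicate_succ]
theorem wI_succ' (s : ℕ) (w : List Bool) : wI s ++ false :: w = wI (s + 1) ++ w := by
  simp [List.replicate_succ']

abbrev wC2 (t e : ℕ) : List Bool := true :: (wI (t + 2) ++ wD (t + 1 + e))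
abbrev wC3 (c : ℕ) : List Bool := wD (c + 1) ++ [false, false]

theorem wC2_num (t e : ℕ) :
    wm (wC2 t e) = wm (wP (t + 2) e) ∧ wM (wC2 t e) = wM (wP (t + 2) e) ∧
    2 * wH (wC2 t e) = 2 * wH (wP (t + 2) e) - (2 * (t + 2 + e) - 5) * (t + 2) * (t + 1) := by
  have h1 := w_top (t + 2) (wD (t + 1 + e))
  have h2 := wE (t + 1 + e)
  have h3 := wP_num (t + 2) e
  rw [List.length_replicate] at h1
  push_cast at *
  refine ⟨by linarith [h1.1, h2.1, h3.1], ?_, ?_⟩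
  · linear_combination h1.2.1 + h2.2.1 - h3.2.1 + 2 * h2.1
  · linear_combination 2 * h1.2.2 + h2.2.2 - h3.2.2 + 2 * h2.2.1 +
      (2 * (t + 2 + (t + 1 + e) + 1) - 5 : ℤ) * h2.1

theorem wC2_len (t e : ℕ) : (wC2 t e).length = 2 * t + e + 4 := by simp; ring

theorem wC3_len (c : ℕ) : (wC3 c).length = c + 3 := by simp

theorem wC3_num (c : ℕ) :
    wm (wC3 c) = wm (wP c 2) ∧ wM (wC3 c) = wM (wP c 2) ∧
    wH (wC3 c) = wH (wP c 2) + 3 := by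
  induction c with
  | zero => decide
  | succ c ih =>
    have l1 := wC3_len c
    have l2 := wP_len c 2
    have e1 : wC3 (c + 1) = true :: wC3 c := by simp [wC3, List.replicate_succ]
    have e2 : wP (c + 1) 2 = true :: wP c 2 := by simp [wP, wC3, wD, wI, List.replicate_succ]
    rw [e1, e2]
    simp only [wm, wM, wH, l1, l2, ih.1, ih.2.1, ih.2.2]
    push_cast
    refine ⟨trivial, trivial, by ring⟩

inductive inC : List Bool → Prop
  | d (e : ℕ) : inC (wD e)
  | p (s b e : ℕ) : inC (wI s ++ wP b e)
  | c2 (s t e : ℕ) : inC (wI s ++ wC2 t e)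
  | c3 (s c : ℕ) : inC (wI s ++ wC3 c)

theorem inC_false {w : List Bool} (h : inC w) : inC (false :: w) := by
  cases h with
  | d e => exact inC.p 0 0 e
  | p s b e => rw [wI_succ]; exact inC.p _ _ _
  | c2 s b e => rw [wI_succ]; exact inC.c2 _ _ _
  | c3 s b => rw [wI_succ]; exact inC.c3 _ _

theorem inC_eq {w v : List Bool} (h : inC v) (e : w = v) : inC w := e ▸ h

theorem inC_true {w : List Bool} (h : inC w) (ho : WOpt (true :: w)) :
    inC (true :: w) ∨ inC (wc (true :: w)) := by
  cases h with
  | d e => exact Or.inl (inC.d (e + 1))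
  | p s b e =>
    rcases Nat.eq_zero_or_pos s with rfl | hs
    · exact Or.inl (inC_eq (inC.p 0 (b + 1) e) (by simp [wP, wC3, wD, wI, List.replicate_succ]))
    rcases Nat.eq_zero_or_pos b with rfl | hb
    · by_cases h1 : s ≤ e
      · obtain ⟨t, rfl⟩ := Nat.exists_eq_add_of_le hs
        obtain ⟨z, rfl⟩ := Nat.exists_eq_add_of_le h1
        refine Or.inl (inC_eq (inC.c2 0 t z) ?_)
        have e1 : Nat.succ 0 + t + z = t + 1 + z := by omega
        have e2 : Nat.succ 0 + t + 1 = t + 2 := by omega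
        simp only [wP, wC2, List.replicate_zero, List.nil_append, wI_succ', e1, e2]
      · by_cases h2 : 3 ≤ e
        · exact (L1 s 0 e (Or.inl (by omega)) (by omega) (wopt_tail ho)).elim
        · right
          have : e = 0 ∨ e = 1 ∨ e = 2 := by omega
          rcases this with rfl | rfl | rfl
          · exact inC_eq (inC.p 0 0 (s + 1)) (by simp [wc, wP, wC3, wD, wI, List.replicate_succ'])
          · exact inC_eq (inC.p 1 (s + 1) 0) (by simp [wc, wP, wC3, wD, wI, List.replicate_succ'])
          · exact inC_eq (inC.c3 1 s) (by simp [wc, wP, wC3, wD, wI, List.replicate_succ'])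
    · by_cases h2 : 2 ≤ b + e
      · exact (L2 s b e (by omega) hb hs ho).elim
      · obtain rfl : b = 1 := by omega
        obtain rfl : e = 0 := by omega
        exact Or.inr (inC_eq (inC.p 1 s 1) (by simp [wc, wP, wC3, wD, wI, List.replicate_succ]))
  | c2 s t e =>
    exfalso
    have h2 := wC2_num t e
    refine L2 (s + t + 1) (t + 2) e (by omega) (by omega) (by omega) (wopt_congr ho ?_ ?_ ?_)
    · simp; ring
    · simp [wm, wm_I, ← h2.1]; ring
    · simp [wM, wm_I, wM_I, ← h2.1, ← h2.2.1]; ring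
  | c3 s c =>
    rcases Nat.eq_zero_or_pos s with rfl | hs
    · exact Or.inl (inC_eq (inC.c3 0 (c + 1)) (by simp [wP, wC3, wD, wI, List.replicate_succ]))
    rcases Nat.eq_zero_or_pos c with rfl | hb
    · exact Or.inr (inC_eq (inC.p 1 s 2) (by simp [wc, wP, wC3, wD, wI, List.replicate_succ]))
    · exfalso
      have h2 := wC3_num c
      refine L2 s c 2 (by omega) (by omega) (by omega) (wopt_congr ho ?_ ?_ ?_)
      · simp
      · simp only [wm, wm_I, ← h2.1]; simp; ring
      · simp only [wM, wm_I, wM_I, ← h2.1, ← h2.2.1]; simp; ring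

theorem wclass {w : List Bool} (h : WOpt w) : inC w ∨ inC (wc w) := by
  induction w with
  | nil => exact Or.inl (inC.d 0)
  | cons x w ih =>
    have ih := ih (wopt_tail h)
    cases x
    · rcases ih with ih | ih
      · exact Or.inl (inC_false ih)
      · have := inC_true ih (by simpa [wc_cons] using wopt_c h)
        rw [wc_cons]
        rcases this with h1 | h1
        · exact Or.inr h1
        · left; simpa [wc_cons] using h1
    · rcases ih with ih | ih
      · exact inC_true ih h
      · exact Or.inr (inC_false ih)


theorem idD (N k b q c : ℤ)
    (hm : k * (k - 1) + 2 * b + (q * (q - 1) + 2 * c) = (N + 1) * N)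
    (ht : (k * (k - 1) + 2 * b) * (N + 1 - k) + c * (c + 1)
      = (q * (q - 1) + 2 * c) * (N + 1 - q) + b * (b + 1)) :
    (k * (k - 1) * (k^2 - 4 * k + 5) + 2 * b * k * (k - 1) + (2 * k - 7) * (b^2 - b) + 2 * b^2) +
    (q * (q - 1) * (q^2 - 4 * q + 5) + 2 * c * q * (q - 1) + (2 * q - 7) * (c^2 - c) + 2 * c^2) -
    (((N + 1) * N - (k * (k - 1) + 2 * b))^2
      - (N + 1) * N^2 - 2 * ((N + 1) * N) * (N - 1)
      + 8 * (k * (k - 1) + 2 * b) * N - (k * (k - 1) + 2 * b) * N^2 + (2 * N - 7) * 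
        (k * (k - 1)^2 + b * (2 * k - 1) + b^2))
     = (q * (q - 1) + 2 * c) * (N + 1 - q) * (N + 1 - q - 2) - 2 * b * (k - b) * (k - 3)
      - (2 * (N + 1 - q) - 1) * c^2 + c * (2 * q - 2 * (N + 1 - q) + 3) := by
  linear_combination (N^2 - 2 * N + 2) * hm + (2 * N - 4) * ht

def WHmax (w : List Bool) : Prop :=
  WOpt w ∧ ∀ v : List Bool, v.length = w.length → wm v = wm w → WOpt v → wH v ≤ wH w

theorem wopt_M {w v : List Bool} (hw : WOpt w) (hv : WOpt v) (hl : v.length = w.length)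
    (hm : wm v = wm w) : wM v = wM w := le_antisymm (hw v hl hm) (hv w hl.symm hm.symm)

theorem whmax_tail {x : Bool} {w : List Bool} (h : WHmax (x :: w)) : WHmax w := by
  refine ⟨wopt_tail h.1, fun v hl hm hv => ?_⟩
  have hM := wopt_M (wopt_tail h.1) hv hl hm
  have := h.2 (x :: v) (by simp [hl])
  cases x
  · simpa [wH] using this (by simpa [wm] using hm)
      (wopt_congr h.1 (by simp [hl]) (by simpa [wm] using hm) (by simpa [wM] using hM))
  · have := this (by simp [wm, hl, hm])
      (wopt_congr h.1 (by simp [hl]) (by simp [wm, hl, hm]) (by simp [wM, hl, hm, hM]))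
    simp only [wH, hl, hm, hM] at this
    linarith

theorem wm_nonneg (w : List Bool) : 0 ≤ wm w := by
  induction w with
  | nil => simp [wm]
  | cons x w ih => cases x <;> simp only [wm] <;> omega

theorem wm_le (w : List Bool) : 2 * wm w ≤ (w.length + 1) * w.length := by
  have := wm_nonneg (wc w)
  have := (wc_num w).1
  linarith

/-- all words of a given length -/
def wds : ℕ → List (List Bool)
  | 0 => [[]]
  | n + 1 => (wds n).map (List.cons false) ++ (wds n).map (List.cons true)

theorem mem_wds (n : ℕ) (w : List Bool) (h : w.length = n) : w ∈ wds n := by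
  induction n generalizing w with
  | zero => simp [wds]; simpa using h
  | succ n ih =>
    cases w with
    | nil => simp at h
    | cons x w => cases x <;> simp [wds, ih w (by simpa using h)]

theorem wds_len (n : ℕ) (w : List Bool) (h : w ∈ wds n) : w.length = n := by
  induction n generalizing w with
  | zero => simp [wds] at h; simp [h]
  | succ n ih =>
    simp only [wds, List.mem_append, List.mem_map] at h
    rcases h with ⟨a, h, rfl⟩ | ⟨a, h, rfl⟩ <;> simp [ih a h]

def smallB (N : ℕ) : Bool := (wds N).all fun u => (wds N).all fun v =>
  !(decide (wm (false :: u) = wm (true :: v))) || !(decide (wM (false :: u) = wM (true :: v)))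
    || !(decide (wH (false :: u) = wH (true :: v))) ||
    (wds (N + 1)).any fun x => decide (wm x = wm (false :: u)) &&
      (decide (wM (false :: u) < wM x) ||
        (decide (wM x = wM (false :: u)) && decide (wH (false :: u) < wH x)))

theorem small_all : (List.range 6).all smallB = true := by decide +kernel

theorem cross_small (u v : List Bool) (hl : u.length = v.length) (hN : u.length < 6)
    (hm : wm (false :: u) = wm (true :: v)) (h1 : WHmax (false :: u)) (h2 : WHmax (true :: v)) :
    False := by
  have hs := small_all
  rw [List.all_eq_true] at hs
  have hs := hs _ (List.mem_range.mpr hN)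
  rw [smallB, List.all_eq_true] at hs
  have hs := hs u (mem_wds _ _ rfl)
  rw [List.all_eq_true] at hs
  have hs := hs v (mem_wds _ _ hl.symm)
  have hll : (true :: v).length = (false :: u).length := by simp [hl]
  have hM := wopt_M h1.1 h2.1 hll hm.symm
  have hH : wH (true :: v) = wH (false :: u) :=
    le_antisymm (h1.2 _ hll hm.symm h2.1) (h2.2 _ hll.symm hm h1.1)
  simp only [hm, hM.symm, hH.symm, decide_true, Bool.not_true, Bool.false_or] at hs
  rw [List.any_eq_true] at hs
  obtain ⟨x, hx, hs⟩ := hs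
  have hxl := wds_len _ _ hx
  simp only [Bool.and_eq_true, Bool.or_eq_true, decide_eq_true_eq] at hs
  have hxl2 : x.length = (true :: v).length := by simp [hxl, hl]
  rcases hs.2 with h | h
  · exact absurd (h2.1 x hxl2 hs.1) (not_le.mpr h)
  · exact absurd (h2.2 x hxl2 hs.1 (wopt_congr h2.1 hxl2 hs.1 h.1)) (not_le.mpr h.2)

/-- numerical data of a word in the class -/
inductive CT (w : List Bool) (s b e : ℕ) : Prop
  | t1 (h : w = wI s ++ wP b e) (hH : wH w = wH (wP b e)) : CT w s b e
  | t3 (h0 : e = 2) (h : w = wI s ++ wC3 b) (hH : wH w = wH (wP b e) + 3) : CT w s b e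
  | t2 (h2 : 2 ≤ b) (hs : b ≤ s + 1) (h : w = wI (s + 1 - b) ++ wC2 (b - 2) e)
      (hH : 2 * wH w = 2 * wH (wP b e) - (2 * (b + e) - 5) * b * (b - 1)) : CT w s b e

theorem Cn {w : List Bool} (h : inC w) (h1 : 1 ≤ w.length)
    (hm : 2 * wm w ≤ w.length * (w.length - 1)) :
    ∃ s b e, w.length = s + b + e + 1 ∧ wm w = wm (wP b e) ∧ wM w = wM (wP b e) ∧
      (s = 0 → b = 0) ∧ CT w s b e := by
  have key : ∀ s b e : ℕ, w.length = s + b + e + 1 → wm w = wm (wP b e) → s = 0 → b = 0 := by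
    rintro s b e hl hmw rfl
    rw [hmw, (wP_num b e).1, hl] at hm
    push_cast at hm
    have : (b : ℤ) ≤ 0 := by linarith
    omega
  cases h with
  | d e =>
    exfalso
    rw [(wE e).1, List.length_replicate] at hm
    simp at h1
    have : (1 : ℤ) ≤ e := by exact_mod_cast h1
    linarith
  | p s b e =>
    have hl : (wI s ++ wP b e).length = s + b + e + 1 := by simp; ring
    exact ⟨s, b, e, hl, wm_I _ _, wM_I _ _, key _ _ _ hl (wm_I _ _), CT.t1 rfl (wH_I _ _)⟩
  | c2 s t e =>
    have hl : (wI s ++ wC2 t e).length = (s + t + 1) + (t + 2) + e + 1 := by simp; ring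
    have hn := wC2_num t e
    refine ⟨s + t + 1, t + 2, e, hl, (wm_I _ _).trans hn.1, (wM_I _ _).trans hn.2.1,
      key _ _ _ hl ((wm_I _ _).trans hn.1), CT.t2 (by omega) (by omega) ?_ ?_⟩
    · congr 2; omega
    · rw [wH_I, hn.2.2]; push_cast; ring
  | c3 s c =>
    have hl : (wI s ++ wC3 c).length = s + c + 2 + 1 := by simp; ring
    have hn := wC3_num c
    exact ⟨s, c, 2, hl, (wm_I _ _).trans hn.1, (wM_I _ _).trans hn.2.1,
      key _ _ _ hl ((wm_I _ _).trans hn.1), CT.t3 rfl rfl (by rw [wH_I, hn.2.2])⟩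

theorem wI_head {s : ℕ} {w v : List Bool} (h : true :: w = wI s ++ v) : s = 0 := by
  cases s with
  | zero => rfl
  | succ s => simp [List.replicate_succ] at h

/-- a head-`true` word of the class with few edges has the second type -/
theorem CT_true {w : List Bool} {s b e : ℕ} (h : CT (true :: w) s b e) (h0 : s = 0 → b = 0)
    (hl : (true :: w).length = s + b + e + 1) (h7 : 7 ≤ (true :: w).length) :
    2 ≤ b ∧ b ≤ s + 1 ∧ true :: w = wI (s + 1 - b) ++ wC2 (b - 2) e ∧
      2 * wH (true :: w) = 2 * wH (wP b e) - (2 * (b + e) - 5) * b * (b - 1) := by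
  cases h with
  | t1 h hH =>
    exfalso
    obtain rfl := wI_head h
    obtain rfl := h0 rfl
    simp [wP] at h
  | t3 h1 h hH =>
    exfalso
    obtain rfl := wI_head h
    obtain rfl := h0 rfl
    omega
  | t2 h2 hs h hH => exact ⟨h2, hs, h, hH⟩

theorem four_le {b e : ℕ} (h : 7 ≤ wm (wP b e)) : 4 ≤ b + e + 1 := by
  by_contra hc
  have := (wP_num b e).1
  have h1 : b ≤ 2 := by omega
  have h2 : e ≤ 2 := by omega
  interval_cases b <;> interval_cases e <;> simp at this <;> omega

theorem par_unique {b e b' e' : ℕ} (h : wm (wP b e) = wm (wP b' e')) : b = b' ∧ e = e' := by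
  have h1 := (wP_num b e).1
  have h2 := (wP_num b' e').1
  rw [h, h2] at h1
  have hk : b + e = b' + e' := by
    rcases lt_trichotomy (b + e) (b' + e') with hlt | heq | hlt
    · exfalso
      obtain ⟨t, ht⟩ := Nat.exists_eq_add_of_lt hlt
      have : (b' : ℤ) + e' = b + e + t + 1 := by exact_mod_cast ht
      rw [this] at h1
      nlinarith
    · exact heq
    · exfalso
      obtain ⟨t, ht⟩ := Nat.exists_eq_add_of_lt hlt
      have : (b : ℤ) + e = b' + e' + t + 1 := by exact_mod_cast ht
      rw [this] at h1
      nlinarith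
  have : (b : ℤ) + e = b' + e' := by exact_mod_cast hk
  rw [this] at h1
  have : (b : ℤ) = b' := by linarith
  omega

theorem pen_pos {b e : ℕ} (h2 : 2 ≤ b) (h4 : 4 ≤ b + e + 1) :
    (0 : ℤ) < (2 * (b + e) - 5) * b * (b - 1) := by
  have h2' : (2 : ℤ) ≤ b := by exact_mod_cast h2
  have h4' : (4 : ℤ) ≤ b + e + 1 := by exact_mod_cast h4
  apply mul_pos (mul_pos _ _) <;> linarith


theorem wopt_P {w : List Bool} {s b e : ℕ} (h : WOpt w) (hl : w.length = s + b + e + 1)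
    (hm : wm w = wm (wP b e)) (hM : wM w = wM (wP b e)) : WOpt (wI s ++ wP b e) := by
  refine wopt_congr h ?_ ((wm_I _ _).trans hm.symm) ((wM_I _ _).trans hM.symm)
  rw [hl]; simp; ring

theorem cross_big (u v : List Bool) (hl : u.length = v.length) (hN : 6 ≤ u.length)
    (hm : wm (false :: u) = wm (true :: v)) (h1 : WHmax (false :: u)) (h2 : WHmax (true :: v)) :
    False := by
  have hll : (true :: v).length = (false :: u).length := by simp [hl]
  have hM := wopt_M h1.1 h2.1 hll hm.symm
  have hH : wH (true :: v) = wH (false :: u) :=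
    le_antisymm (h1.2 _ hll hm.symm h2.1) (h2.2 _ hll.symm hm h1.1)
  have hlo : (u.length : ℤ) + 1 ≤ wm (false :: u) := by
    rw [hm]; simp only [wm, hl]; linarith [wm_nonneg v]
  have hhi : 2 * wm (false :: u) ≤ (u.length + 1) * u.length := by
    simp only [wm]; exact wm_le u
  have hcv := wc_num (true :: v)
  have hcu := wc_num (false :: u)
  have hN' : (6 : ℤ) ≤ u.length := by exact_mod_cast hN
  have hLv : ((true :: v).length : ℤ) = u.length + 1 := by simp [hl]
  have hLu : ((false :: u).length : ℤ) = u.length + 1 := by simp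
  rw [hLv, ← hm, hM, hH] at hcv
  rw [hLu] at hcu
  have hcm : wm (wc (false :: u)) = wm (wc (true :: v)) := by linarith [hcv.1, hcu.1]
  have hcH : wH (wc (false :: u)) = wH (wc (true :: v)) := by linarith [hcv.2.2, hcu.2.2]
  have hlo' : (u.length : ℤ) + 1 ≤ wm (wc (true :: v)) := by linarith [hcv.1]
  have hhi' : 2 * wm (wc (true :: v)) ≤ (u.length + 1) * u.length := by linarith [hcv.1]
  have hov := wopt_c h2.1
  -- the word with head true is not in the class
  have hv : inC (wc (true :: v)) := by
    refine (wclass h2.1).resolve_left fun hin => ?_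
    obtain ⟨s, b, e, hlen, em, eM, hsb, hct⟩ := Cn hin (by simp) (by
      rw [hLv, ← hm]; linarith)
    obtain ⟨hb2, -, -, hpen⟩ := CT_true hct hsb hlen (by simp; omega)
    have h4 : 4 ≤ b + e + 1 := four_le (by rw [← em, ← hm]; linarith)
    have hp := h2.2 (wI s ++ wP b e) (by rw [hlen]; simp; ring) (by rw [wm_I, em])
      (wopt_P h2.1 hlen em eM)
    rw [wH_I] at hp
    linarith [pen_pos hb2 h4]
  obtain ⟨s', c, e', hlen', em', eM', hsb', hct'⟩ := Cn hv (by simp) (by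
      rw [wc_len, hLv]; linarith)
  rw [wc_len] at hlen'
  have hq4 : 4 ≤ c + e' + 1 := four_le (by rw [← em']; linarith)
  have hu : inC (false :: u) := by
    refine (wclass h1.1).resolve_right fun hin => ?_
    obtain ⟨s, b, e, hlen, em, eM, hsb, hct⟩ := Cn hin (by simp) (by
      rw [wc_len, hLu, hcm]; linarith)
    obtain ⟨rfl, rfl⟩ := par_unique (em.symm.trans (hcm.trans em'))
    rw [wc_len] at hlen
    obtain rfl : s = s' := by omega
    obtain ⟨hb2, hbs, hw, hpen⟩ := CT_true (w := wc u) hct hsb (by simpa using hlen) (by simp; omega)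
    have hpp := pen_pos hb2 hq4
    have hcH' : wH (true :: wc u) = wH (wc (true :: v)) := hcH
    cases hct' with
    | t1 h hh => linarith
    | t3 h0 h hh => linarith
    | t2 _ _ h hh =>
      rw [← hw] at h
      simp [wc_cons] at h
  obtain ⟨s, b, e, hlen, em, eM, hsb, hct⟩ := Cn hu (by simp) (by rw [hLu]; linarith)
  have hk4 : 4 ≤ b + e + 1 := four_le (by rw [← em]; linarith)
  have hoP := wopt_P h1.1 hlen em eM
  have hoQ := wopt_P hov (by simpa using hlen') em' eM'
  have hs1 : ¬ (b + e + 1 ≤ s + 1) := fun h => L1 s b e (Or.inl hk4) h hoP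
  have hs2 : ¬ (c + e' + 1 ≤ s' + 1) := fun h => L1 s' c e' (Or.inl hq4) h hoQ
  have hP := wP_num b e
  have hQ := wP_num c e'
  have hHv := h2.2 (wI s ++ wP b e) (by rw [hll, hlen]; simp; ring) (by rw [wm_I, ← em, hm]) hoP
  rw [wH_I, hH] at hHv
  rw [← em, ← eM] at hP
  rw [← em', ← eM'] at hQ
  simp only [List.length_cons] at hlen hlen'
  obtain ⟨k, hk⟩ : ∃ k : ℕ, k = b + e + 1 := ⟨_, rfl⟩
  obtain ⟨q, hq⟩ : ∃ q : ℕ, q = c + e' + 1 := ⟨_, rfl⟩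
  have hkz : (b : ℤ) + e = k - 1 := by omega
  have hqz : (c : ℤ) + e' = q - 1 := by omega
  rw [hkz, sub_add_cancel] at hP
  rw [hqz, sub_add_cancel] at hQ
  obtain ⟨N, hNN⟩ : ∃ N : ℕ, N = u.length + 1 := ⟨_, rfl⟩
  have hNz : (u.length : ℤ) + 1 = N := by omega
  rw [hNz] at hcv
  have t1 : (k : ℤ) * (k - 1) + 2 * b + (q * (q - 1) + 2 * c) = (N + 1) * N := by
    linear_combination hcv.1 - hP.1 - hQ.1
  have t2 : ((k : ℤ) * (k - 1) + 2 * b) * (N + 1 - k) + c * (c + 1)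
      = (q * (q - 1) + 2 * c) * (N + 1 - q) + b * (b + 1) := by
    linear_combination hcv.2.1 - hQ.2.1 + hP.2.1 - 2 * N * hP.1 - N * t1
  have hD := idD N k b q c t1 t2
  have hnl := NL (N + 1) k b q c (by omega) (by omega) (by omega) (by omega) (by omega)
    (by omega) (by omega) (by push_cast; linear_combination t1) (by push_cast; exact t2)
  push_cast at hnl
  have hF : 2 * wH (wc (true :: v)) + 2 * wH (false :: u) = 
      ((N + 1) * N - (k * (k - 1) + 2 * b))^2
      - (N + 1) * N^2 - 2 * ((N + 1) * N) * (N - 1)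
      + 8 * (k * (k - 1) + 2 * b) * N - (k * (k - 1) + 2 * b) * N^2 + (2 * N - 7) * 
        (k * (k - 1)^2 + b * (2 * k - 1) + b^2) := by
    rw [hcv.2.2, hP.2.1, ← hP.1]; ring
  cases hct' with
  | t1 h hh => linarith [hP.2.2, hQ.2.2, hnl.1]
  | t3 h0 h hh => linarith [hP.2.2, hQ.2.2, hnl.1]
  | t2 h2 hs h hh =>
    have := hnl.2 h2 (by omega)
    rw [hqz] at hh
    linarith [hP.2.2, hQ.2.2]

theorem WT (w : List Bool) : ∀ v : List Bool, w.length = v.length → wm w = wm v → WHmax w →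
    WHmax v → w = v := by
  induction w with
  | nil => intro v hl _ _ _; exact (List.length_eq_zero_iff.mp hl.symm).symm
  | cons x w ih =>
    intro v hl hm h1 h2
    cases v with
    | nil => simp at hl
    | cons y v =>
      have hl' : w.length = v.length := by simpa using hl
      have cr : ∀ u v : List Bool, u.length = v.length → wm (false :: u) = wm (true :: v) →
          WHmax (false :: u) → WHmax (true :: v) → False := by
        intro u v hl hm h1 h2
        rcases lt_or_ge u.length 6 with h | h
        · exact cross_small u v hl h hm h1 h2
        · exact cross_big u v hl h hm h1 h2
      have tl : wm w = wm v → w = v := fun h => ih v hl' h (whmax_tail h1) (whmax_tail h2)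
      cases x <;> cases y
      · rw [tl (by simpa [wm] using hm)]
      · exact (cr w v hl' hm h1 h2).elim
      · exact (cr v w hl'.symm hm.symm h2 h1).elim
      · rw [tl (by simpa [wm, hl'] using hm)]


/-- the graph is built according to the word -/
def IsW : List Bool → (V : Type) → SimpleGraph V → Prop
  | [], V, _ => Nat.card V = 1
  | x :: w, V, G => ∃ v0 : V, (∀ u, u ≠ v0 → (G.Adj v0 u ↔ x = true)) ∧
      IsW w {u : V // u ≠ v0} (G.comap Subtype.val)

open Classical in
theorem isW_exists (w : List Bool) : ∀ (V : Type) [Fintype V], Fintype.card V = w.length + 1 →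
    ∃ G : SimpleGraph V, IsW w V G := by
  induction w with
  | nil => intro V _ h; exact ⟨⊥, by simpa [IsW, Nat.card_eq_fintype_card] using h⟩
  | cons x w ih =>
    intro V _ h
    have : Nonempty V := Fintype.card_pos_iff.mp (by omega)
    obtain ⟨v0⟩ := this
    have hc : Fintype.card {u : V // u ≠ v0} = w.length + 1 := by
      rw [Fintype.card_subtype_compl]; simp [h]
    obtain ⟨G', hG'⟩ := ih _ hc
    refine ⟨SimpleGraph.mk (fun a b => (∃ (ha : a ≠ v0) (hb : b ≠ v0), G'.Adj ⟨a, ha⟩ ⟨b, hb⟩) ∨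
      (x = true ∧ a ≠ b ∧ (a = v0 ∨ b = v0))) ?_ ?_, v0, ?_, ?_⟩
    · refine ⟨?_⟩
      rintro a b (⟨ha, hb, h⟩ | ⟨h1, h2, h3⟩)
      · exact Or.inl ⟨hb, ha, h.symm⟩
      · exact Or.inr ⟨h1, h2.symm, h3.symm⟩
    · refine ⟨?_⟩
      rintro a (⟨ha, hb, h⟩ | ⟨h1, h2, h3⟩)
      · exact G'.loopless.irrefl _ h
      · exact h2 rfl
    · intro u hu
      simp [hu.symm]
    · convert hG'
      ext a b
      simp [a.2, b.2]

open Classical in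
theorem isW_iso (w : List Bool) : ∀ (V V' : Type) [Finite V] [Finite V'] (G : SimpleGraph V)
    (G' : SimpleGraph V'), IsW w V G → IsW w V' G' → Nonempty (G ≃g G') := by
  induction w with
  | nil =>
    intro V V' _ _ G G' h h'
    simp only [IsW] at h h'
    have e : V ≃ V' := (Finite.card_eq.mp (h.trans h'.symm)).some
    have s1 : Subsingleton V := (Nat.card_eq_one_iff_unique.mp h).1
    refine ⟨⟨e, ?_⟩⟩
    intro a b
    have hab : a = b := Subsingleton.elim a b
    subst hab
    simp
  | cons x w ih =>
    rintro V V' _ _ G G' ⟨v0, h1, h2⟩ ⟨v0', h1', h2'⟩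
    obtain ⟨f⟩ := ih _ _ _ _ h2 h2'
    let e : V ≃ V' := ((Equiv.optionSubtypeNe v0).symm.trans (Equiv.optionCongr f.toEquiv)).trans
      (Equiv.optionSubtypeNe v0')
    have e0 : e v0 = v0' := by simp [e]
    have e1 : ∀ (a : V) (ha : a ≠ v0), e a = f ⟨a, ha⟩ := by
      intro a ha
      simp [e, ha]
    refine ⟨⟨e, ?_⟩⟩
    intro a b
    by_cases ha : a = v0
    · subst ha
      by_cases hb : b = a
      · subst hb; simp
      · rw [e0, h1 b hb, h1']
        rw [e1 b hb]; exact (f ⟨b, hb⟩).2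
    · by_cases hb : b = v0
      · subst hb
        rw [SimpleGraph.adj_comm, SimpleGraph.adj_comm G, e0, h1 a ha, h1']
        rw [e1 a ha]; exact (f ⟨a, ha⟩).2
      · rw [e1 a ha, e1 b hb]
        exact f.map_rel_iff (a := ⟨a, ha⟩) (b := ⟨b, hb⟩)

/-- degree -/
noncomputable def dg {V : Type} (G : SimpleGraph V) (v : V) : ℕ := (G.neighborSet v).ncard

theorem dg_sum {V : Type} [Fintype V] (G : SimpleGraph V) : ∑ v, dg G v = 2 * edgeCount G := by
  classical
  have := G.sum_degrees_eq_twice_card_edges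
  rw [edgeCount, Set.ncard_eq_toFinset_card']
  rw [SimpleGraph.edgeFinset] at this
  rw [← this]
  refine Finset.sum_congr rfl fun v _ => ?_
  rw [dg, Set.ncard_eq_toFinset_card', ← SimpleGraph.card_neighborFinset_eq_degree]
  rfl

open Classical in
theorem dg_eq {V : Type} [Fintype V] (G : SimpleGraph V) (u : V) :
    dg G u = ∑ v, if G.Adj u v then 1 else 0 := by
  rw [dg, Set.ncard_eq_toFinset_card', Finset.sum_boole]
  rw [Nat.cast_id]
  congr 1
  ext v
  simp

open Classical in
noncomputable def S2 {V : Type} [Fintype V] (G : SimpleGraph V) : ℕ :=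
  ∑ u, ∑ v, if G.Adj u v then dg G u * dg G v else 0

noncomputable def Kc {V : Type} (G : SimpleGraph V) (r : ℕ) : ℕ :=
  {s : Finset V | G.IsNClique r s}.ncard


section step
variable {V : Type} [Fintype V] (G : SimpleGraph V) (v0 : V) 

abbrev Gs (G : SimpleGraph V) (v0 : V) : SimpleGraph {u : V // u ≠ v0} := G.comap Subtype.val

open Classical in
theorem st_sum (f : V → ℕ) : ∑ v, f v = f v0 + ∑ u : {u : V // u ≠ v0}, f u :=
  Fintype.sum_eq_add_sum_subtype_ne f v0

theorem st_dg0 (x : Bool) (h : ∀ u, u ≠ v0 → (G.Adj v0 u ↔ x = true)) :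
    dg G v0 = if x then Nat.card {u : V // u ≠ v0} else 0 := by
  classical
  rw [dg_eq, st_sum v0, Finset.sum_congr rfl (g := fun _ => if x then 1 else 0)
    (fun u _ => by simp [h u u.2])]
  cases x <;> simp

theorem st_dg (x : Bool) (h : ∀ u, u ≠ v0 → (G.Adj v0 u ↔ x = true)) (u : {u : V // u ≠ v0}) :
    dg G u = dg (Gs G v0) u + if x then 1 else 0 := by
  classical
  rw [dg_eq, st_sum v0, dg_eq, add_comm]
  congr 1
  simp [G.adj_comm u v0, h u u.2]

open Classical in
theorem st_S2 (x : Bool) (h : ∀ u, u ≠ v0 → (G.Adj v0 u ↔ x = true)) :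
    S2 G = ∑ u : {u : V // u ≠ v0}, (if x then 2 * dg G v0 * dg G u else 0) +
      ∑ u : {u : V // u ≠ v0}, ∑ v : {u : V // u ≠ v0},
        if (Gs G v0).Adj u v then dg G u * dg G v else 0 := by
  rw [S2, st_sum v0, st_sum v0]
  simp only [SimpleGraph.irrefl, if_false, zero_add]
  have : ∀ u : {u : V // u ≠ v0}, (∑ v, if G.Adj u v then dg G u * dg G v else 0)
      = (if x then dg G u * dg G v0 else 0) +
      ∑ v : {u : V // u ≠ v0}, if (Gs G v0).Adj u v then dg G u * dg G v else 0 := by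
    intro u
    rw [st_sum v0]
    simp [G.adj_comm u v0, h u u.2]
  rw [Finset.sum_congr rfl (fun u _ => this u), Finset.sum_add_distrib, ← add_assoc,
    ← Finset.sum_add_distrib]
  congr 1
  refine Finset.sum_congr rfl fun u _ => ?_
  simp only [h u u.2]
  cases x <;> simp
  ring

open Classical in
theorem dd (G : SimpleGraph V) : ∑ u, ∑ v, (if G.Adj u v then
    (dg G u + 1) * (dg G v + 1) else 0) = S2 G + 2 * M1 G + 2 * edgeCount G := by
  have h1 : ∑ u, ∑ v, (if G.Adj u v then dg G u else 0) = M1 G := by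
    refine Finset.sum_congr rfl fun u _ => ?_
    have : ∑ v, (if G.Adj u v then dg G u else 0) = dg G u * ∑ v, (if G.Adj u v then 1 else 0) := by
      rw [Finset.mul_sum]; simp
    rw [this, ← dg_eq, sq]; rfl
  have h2 : ∑ u, ∑ v, (if G.Adj u v then dg G v else 0) = M1 G := by
    rw [Finset.sum_comm, ← h1]
    simp only [G.adj_comm]
  have h3 : ∑ u, ∑ v, (if G.Adj u v then 1 else 0) = 2 * edgeCount G := by
    rw [← dg_sum]
    refine Finset.sum_congr rfl fun u _ => (dg_eq G u).symm
  rw [← h3, two_mul, ← add_assoc, S2]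
  nth_rewrite 1 [← h1]
  rw [← h2]
  simp only [← Finset.sum_add_distrib]
  refine Finset.sum_congr rfl fun u _ => Finset.sum_congr rfl fun v _ => ?_
  split_ifs <;> ring

open Classical in
theorem st_true (h : ∀ u, u ≠ v0 → (G.Adj v0 u ↔ true = true)) (X : ℕ)
    (hX : Nat.card {u : V // u ≠ v0} = X) :
    edgeCount G = edgeCount (Gs G v0) + X ∧
    (M1 G = M1 (Gs G v0) + X^2 + X + 4 * edgeCount (Gs G v0)) ∧
    (S2 G = S2 (Gs G v0) + 2 * M1 (Gs G v0) + 2 * edgeCount (Gs G v0)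
      + 4 * X * edgeCount (Gs G v0) + 2 * X^2) := by
  have h0 := st_dg0 G v0 true h
  have h1 := st_dg G v0 true h
  simp only [if_true] at h0 h1
  rw [hX] at h0
  have hs := dg_sum (Gs G v0)
  have hc : ∑ _u : {u : V // u ≠ v0}, 1 = X := by
    rw [← hX, Nat.card_eq_fintype_card]; simp
  refine ⟨?_, ?_, ?_⟩
  · have h2 := dg_sum G
    rw [st_sum v0, h0] at h2
    simp only [h1, Finset.sum_add_distrib, hs, hc] at h2
    omega
  · change ∑ v, dg G v ^ 2 = ∑ v, dg (Gs G v0) v ^ 2 + X^2 + X + 4 * edgeCount (Gs G v0)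
    rw [st_sum v0, h0]
    have : ∀ u : {u : V // u ≠ v0}, dg G u ^ 2 = dg (Gs G v0) u ^ 2 + 2 * dg (Gs G v0) u + 1 := by
      intro u; rw [h1]; ring
    simp only [this, Finset.sum_add_distrib, ← Finset.mul_sum, hs, hc]
    ring
  · rw [st_S2 G v0 true h]
    simp only [h1, h0, if_true]
    rw [← Finset.mul_sum, Finset.sum_add_distrib, hs, hc]
    trans 2 * X * (2 * edgeCount (Gs G v0) + X) +
      (S2 (Gs G v0) + 2 * M1 (Gs G v0) + 2 * edgeCount (Gs G v0))
    · congr 1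
      convert dd (Gs G v0)
    · ring

open Classical in
theorem st_false (h : ∀ u, u ≠ v0 → (G.Adj v0 u ↔ false = true)) :
    edgeCount G = edgeCount (Gs G v0) ∧
    (M1 G = M1 (Gs G v0)) ∧
    (S2 G = S2 (Gs G v0)) := by
  have h0 := st_dg0 G v0 false h
  have h1 := st_dg G v0 false h
  simp only [Bool.false_eq_true, if_false, add_zero] at h0 h1
  have hs := dg_sum (Gs G v0)
  refine ⟨?_, ?_, ?_⟩
  · have h2 := dg_sum G
    rw [st_sum v0, h0] at h2
    simp only [h1, hs] at h2
    omega
  · change ∑ v, dg G v ^ 2 = ∑ v, dg (Gs G v0) v ^ 2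
    rw [st_sum v0, h0]
    simp [h1]
  · rw [st_S2 G v0 false h]
    simp [h1, S2]


theorem Kc_step (r : ℕ) : Kc G (r + 1) = Kc (Gs G v0) (r + 1) +
    {s : Finset {u : V // u ≠ v0} | (Gs G v0).IsNClique r s ∧ ∀ u ∈ s, G.Adj v0 u}.ncard := by
  classical
  let em : {u : V // u ≠ v0} ↪ V := Function.Embedding.subtype _
  have hv : ∀ s : Finset {u : V // u ≠ v0}, v0 ∉ s.map em := by
    intro s hs
    obtain ⟨a, _, ha⟩ := Finset.mem_map.mp hs
    exact a.2 ha
  have hcl : ∀ s : Finset {u : V // u ≠ v0}, G.IsClique (s.map em : Finset V) ↔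
      (Gs G v0).IsClique (s : Set _) := by
    intro s
    constructor
    · intro h a ha b hb hab
      exact h (by simpa [em] using ⟨a.2, ha⟩) (by simpa [em] using ⟨b.2, hb⟩)
        (fun h => hab (Subtype.ext h))
    · intro h a ha b hb hab
      simp only [Finset.coe_map, Set.mem_image, em] at ha hb
      obtain ⟨a, ha, rfl⟩ := ha
      obtain ⟨b, hb, rfl⟩ := hb
      exact h ha hb (fun h => hab (by rw [h]))
  have hsub : ∀ s : Finset V, v0 ∉ s → ∃ t : Finset {u : V // u ≠ v0}, t.map em = s := by
    intro s hs
    exact ⟨s.subtype _, Finset.subtype_map_of_mem fun x hx h => hs (h ▸ hx)⟩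
  have hset : {s : Finset V | G.IsNClique (r + 1) s} =
      (fun s => s.map em) '' {s | (Gs G v0).IsNClique (r + 1) s} ∪
      (fun s => insert v0 (s.map em)) ''
        {s | (Gs G v0).IsNClique r s ∧ ∀ u ∈ s, G.Adj v0 u} := by
    ext s
    simp only [Set.mem_ofPred_eq, Set.mem_union, Set.mem_image]
    constructor
    · intro h
      by_cases h0 : v0 ∈ s
      · right
        obtain ⟨t, ht⟩ := hsub (s.erase v0) (by simp)
        refine ⟨t, ⟨⟨?_, ?_⟩, ?_⟩, by rw [ht, Finset.insert_erase h0]⟩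
        · rw [← hcl, ht]
          exact h.1.subset (by simp)
        · rw [← Finset.card_map em, ht, Finset.card_erase_of_mem h0, h.2]; rfl
        · intro u hu
          have hu' : (u : V) ∈ s.erase v0 := by rw [← ht]; exact Finset.mem_map_of_mem em hu
          exact h.1 (by simpa using h0) (by simpa using (Finset.mem_erase.mp hu').2) u.2.symm
      · left
        obtain ⟨t, ht⟩ := hsub s h0
        exact ⟨t, ⟨by rw [← hcl, ht]; exact h.1, by rw [← Finset.card_map em, ht, h.2]⟩, ht⟩
    · rintro (⟨t, ht, rfl⟩ | ⟨t, ⟨ht, ha⟩, rfl⟩)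
      · exact ⟨(hcl t).mpr ht.1, by rw [Finset.card_map, ht.2]⟩
      · refine ⟨?_, by rw [Finset.card_insert_of_notMem (hv t), Finset.card_map, ht.2]⟩
        rw [Finset.coe_insert, SimpleGraph.isClique_insert]
        refine ⟨(hcl t).mpr ht.1, ?_⟩
        intro b hb _
        simp only [Finset.coe_map, Set.mem_image, em] at hb
        obtain ⟨b, hb, rfl⟩ := hb
        exact ha b hb
  rw [Kc, hset, Set.ncard_union_eq, Set.ncard_image_of_injective, Set.ncard_image_of_injective]
  · rfl
  · intro s t h
    have h2 : (insert v0 (s.map em)).erase v0 = (insert v0 (t.map em)).erase v0 := by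
      simp only at h; rw [h]
    rw [Finset.erase_insert (hv s), Finset.erase_insert (hv t)] at h2
    exact Finset.map_injective em h2
  · exact Finset.map_injective em
  · rw [Set.disjoint_left]
    rintro _ ⟨s, _, rfl⟩ ⟨t, _, h⟩
    apply hv s
    simp only at h
    rw [← h]; simp

theorem Kc_true (h : ∀ u, u ≠ v0 → (G.Adj v0 u ↔ true = true)) (r : ℕ) :
    Kc G (r + 1) = Kc (Gs G v0) (r + 1) + Kc (Gs G v0) r := by
  rw [Kc_step G v0]
  congr 2
  ext s
  simp only [Set.mem_ofPred_eq, and_iff_left_iff_imp]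
  intro _ u _
  exact (h u u.2).mpr rfl

theorem Kc_false (h : ∀ u, u ≠ v0 → (G.Adj v0 u ↔ false = true)) (r : ℕ) :
    Kc G (r + 2) = Kc (Gs G v0) (r + 2) := by
  rw [Kc_step G v0]
  have : {s : Finset {u : V // u ≠ v0} | (Gs G v0).IsNClique (r + 1) s ∧ ∀ u ∈ s, G.Adj v0 u}
      = ∅ := by
    ext s
    simp only [Set.mem_ofPred_eq, Set.mem_empty_iff_false, iff_false, not_and]
    intro hs ha
    have : s.Nonempty := by rw [← Finset.card_pos, hs.2]; omega
    obtain ⟨u, hu⟩ := this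
    have := (h u u.2).mp (ha u hu)
    simp at this
  rw [this]; simp

end step

theorem Kc_one {V : Type} (G : SimpleGraph V) [Fintype V] : Kc G 1 = Nat.card V := by
  have : {s : Finset V | G.IsNClique 1 s} = Set.range (fun v => ({v} : Finset V)) := by
    ext s
    simp [SimpleGraph.isNClique_one, eq_comm]
  rw [Kc, this, ← Set.image_univ, Set.ncard_image_of_injective _ Finset.singleton_injective,
    Set.ncard_univ]

open Classical in
theorem isW_num (w : List Bool) : ∀ (V : Type) [Fintype V] (G : SimpleGraph V), IsW w V G →
    Nat.card V = w.length + 1 ∧ (edgeCount G : ℤ) = wm w ∧ (M1 G : ℤ) = wM w ∧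
    (∃ t : ℕ, S2 G = 2 * t ∧ (t : ℤ) - 6 * Kc G 3 = wH w) ∧ Kc G 2 = edgeCount G := by
  induction w with
  | nil =>
    intro V _ G h
    simp only [IsW] at h
    have hs : Subsingleton V := (Nat.card_eq_one_iff_unique.mp h).1
    have hb : ∀ a b, ¬ G.Adj a b := by
      intro a b hab
      exact G.ne_of_adj hab (Subsingleton.elim a b)
    have hd : ∀ v, dg G v = 0 := by
      intro v; rw [dg_eq]; simp [hb]
    have he : edgeCount G = 0 := by
      have := dg_sum G
      simp [hd] at this
      omega
    have hk : ∀ r, Kc G (r + 2) = 0 := by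
      intro r
      rw [Kc, Set.ncard_eq_zero]
      ext s
      simp only [Set.mem_ofPred_eq, Set.mem_empty_iff_false, iff_false]
      intro hs'
      have := Finset.card_le_one_of_subsingleton s
      have := hs'.2
      omega
    refine ⟨h, by simp [he, wm], ?_, ⟨0, ?_, ?_⟩, ?_⟩
    · have : M1 G = ∑ v, dg G v ^ 2 := rfl
      simp [this, hd, wM]
    · simp [S2, hd]
    · simp [hk 1, wH]
    · rw [he, hk 0]
  | cons x w ih =>
    rintro V _ G ⟨v0, h, hw⟩
    obtain ⟨i1, i2, i3, ⟨t, i4, i5⟩, i6⟩ := ih _ _ hw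
    have hcard : Nat.card V = w.length + 2 := by
      have := Kc_one G
      rw [Kc_step G v0, Kc_one, i1] at this
      rw [← this]
      have : {s : Finset {u : V // u ≠ v0} | (Gs G v0).IsNClique 0 s ∧ ∀ u ∈ s, G.Adj v0 u}
          = {∅} := by
        ext s
        simp only [SimpleGraph.isNClique_zero, Set.mem_ofPred_eq, Set.mem_singleton_iff]
        constructor
        · exact fun h => h.1
        · rintro rfl; simp
      rw [this]; simp
    refine ⟨by simpa using hcard, ?_⟩
    cases x
    · obtain ⟨j1, j2, j3⟩ := st_false G v0 h
      rw [j1, Kc_false G v0 h, Kc_false G v0 h]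
      refine ⟨i2, ?_, ⟨t, ?_, i5⟩, i6⟩
      · simp only [wM]; rw [← i3, j2]
      · rw [j3, ← i4]
    · obtain ⟨j1, j2, j3⟩ := st_true G v0 h _ i1
      rw [j1, Kc_true G v0 h, Kc_true G v0 h, Kc_one, i1]
      change Kc (Gs G v0) 2 = edgeCount (Gs G v0) at i6
      change (edgeCount (Gs G v0) : ℤ) = _ at i2
      change (M1 (Gs G v0) : ℤ) = _ at i3
      change S2 (Gs G v0) = _ at i4
      refine ⟨?_, ?_, ⟨t + M1 (Gs G v0) + edgeCount (Gs G v0) +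
        2 * (w.length + 1) * edgeCount (Gs G v0) + (w.length + 1)^2, ?_, ?_⟩, by rw [i6]⟩
      · simp only [wm]; push_cast; rw [i2]
      · simp only [wM]; rw [j2]; push_cast; rw [← i3, ← i2]; ring
      · rw [j3, i4]; ring
      · simp only [wH]; rw [i6]; push_cast; rw [← i5, ← i3, ← i2]; ring



def Nst {V : Type} (G : SimpleGraph V) : Prop :=
  ∀ u v, (∀ x, x ≠ u → x ≠ v → G.Adj v x → G.Adj u x) ∨
    (∀ x, x ≠ u → x ≠ v → G.Adj u x → G.Adj v x)

theorem swap_up {V : Type} [Fintype V] (G : SimpleGraph V) (u v x : V) (hxu : x ≠ u) 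
    (hvx : G.Adj v x) (hux : ¬ G.Adj u x) (hd : dg G v ≤ dg G u) :
    ∃ G' : SimpleGraph V, edgeCount G' = edgeCount G ∧ M1 G < M1 G' := by
  classical
  have hxv : x ≠ v := (G.ne_of_adj hvx).symm
  have huv : u ≠ v := by rintro rfl; exact hux hvx
  let G' : SimpleGraph V := SimpleGraph.fromEdgeSet (insert s(u, x) (G.edgeSet \ {s(v, x)}))
  have hadj : ∀ a b, G'.Adj a b ↔ (s(a, b) = s(u, x) ∨ G.Adj a b ∧ s(a, b) ≠ s(v, x)) := by
    intro a b
    simp only [G', SimpleGraph.fromEdgeSet_adj, Set.mem_insert_iff, Set.mem_diff,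
      SimpleGraph.mem_edgeSet, Set.mem_singleton_iff]
    constructor
    · exact fun h => h.1
    · intro h
      refine ⟨h, ?_⟩
      rcases h with h | h
      · rintro rfl
        simp only [Sym2.eq, Sym2.rel_iff', Prod.mk.injEq, Prod.swap_prod_mk] at h
        rcases h with h | h <;> exact hxu (h.2.symm.trans h.1 |> fun h => by simp_all)
      · exact G.ne_of_adj h.1
  have nu : G'.neighborSet u = insert x (G.neighborSet u) := by
    ext a
    simp only [SimpleGraph.mem_neighborSet, hadj, Set.mem_insert_iff, Sym2.eq, Sym2.rel_iff',
      Prod.mk.injEq, Prod.swap_prod_mk]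
    grind
  have nv : G'.neighborSet v = G.neighborSet v \ {x} := by
    ext a
    simp only [SimpleGraph.mem_neighborSet, hadj, Set.mem_diff, Set.mem_singleton_iff, Sym2.eq,
      Sym2.rel_iff', Prod.mk.injEq, Prod.swap_prod_mk]
    grind
  have nx : G'.neighborSet x = insert u (G.neighborSet x \ {v}) := by
    ext a
    simp only [SimpleGraph.mem_neighborSet, hadj, Set.mem_diff, Set.mem_singleton_iff, Sym2.eq,
      Sym2.rel_iff', Prod.mk.injEq, Prod.swap_prod_mk, Set.mem_insert_iff]
    grind
  have no : ∀ w, w ≠ u → w ≠ v → w ≠ x → G'.neighborSet w = G.neighborSet w := by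
    intro w h1 h2 h3
    ext a
    simp only [SimpleGraph.mem_neighborSet, hadj, Sym2.eq,
      Sym2.rel_iff', Prod.mk.injEq, Prod.swap_prod_mk]
    grind
  have du : dg G' u = dg G u + 1 := by
    rw [dg, nu, Set.ncard_insert_of_notMem (show x ∉ G.neighborSet u from hux)]; rfl
  have dv : dg G' v + 1 = dg G v := by
    rw [dg, nv]; exact Set.ncard_diff_singleton_add_one hvx
  have dx : dg G' x = dg G x := by
    rw [dg, nx, Set.ncard_insert_of_notMem (by
      intro h; exact hux (G.symm.symm _ _ h.1))]
    exact Set.ncard_diff_singleton_add_one (G.symm.symm _ _ hvx)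
  have dw : ∀ w, w ≠ u → w ≠ v → dg G' w = dg G w := by
    intro w h1 h2
    by_cases h3 : w = x
    · rw [h3, dx]
    · rw [dg, no w h1 h2 h3]; rfl
  have e1 : ∀ w, (dg G' w : ℤ) = dg G w + (if w = u then 1 else 0) + (if w = v then -1 else 0) := by
    intro w
    by_cases h1 : w = u
    · subst h1; simp [huv, du]
    · by_cases h2 : w = v
      · subst h2; simp [h1]; omega
      · simp [h1, h2, dw w h1 h2]
  have e2 : ∀ w, ((dg G' w ^ 2 : ℕ) : ℤ) = (dg G w ^ 2 : ℕ) + (if w = u then 2 * (dg G u : ℤ) + 1 else 0)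
      + (if w = v then - 2 * (dg G v : ℤ) + 1 else 0) := by
    intro w
    push_cast
    rw [e1]
    by_cases h1 : w = u
    · subst h1; simp [huv]; ring
    · by_cases h2 : w = v
      · subst h2; simp [h1]; ring
      · simp [h1, h2]
  refine ⟨G', ?_, ?_⟩
  · have h1 : ((2 * edgeCount G' : ℕ) : ℤ) = (2 * edgeCount G : ℕ) := by
      rw [← dg_sum, ← dg_sum]
      rw [Nat.cast_sum, Nat.cast_sum, Finset.sum_congr rfl (fun w _ => e1 w)]
      simp [Finset.sum_add_distrib]
    omega
  · have h1 : (M1 G' : ℤ) = M1 G + (2 * (dg G u : ℤ) + 1) + (- 2 * (dg G v : ℤ) + 1) := by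
      change ((∑ w, dg G' w ^ 2 : ℕ) : ℤ) = ((∑ w, dg G w ^ 2 : ℕ) : ℤ) + _ + _
      rw [Nat.cast_sum, Nat.cast_sum, Finset.sum_congr rfl (fun w _ => e2 w)]
      simp [Finset.sum_add_distrib]
    omega

theorem nst_of_opt {V : Type} [Fintype V] {m : ℕ} {G : SimpleGraph V} (h : MOptimal m G) :
    Nst G := by
  have key : ∀ u v, dg G v ≤ dg G u → ∀ x, x ≠ u → x ≠ v → G.Adj v x → G.Adj u x := by
    intro u v hd x hxu _ hvx
    by_contra hux
    obtain ⟨G', h1, h2⟩ := swap_up G u v x hxu hvx hux hd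
    exact absurd (h.2 G' (h1.trans h.1)) (not_le.mpr h2)
  intro u v
  rcases le_total (dg G v) (dg G u) with hd | hd
  · exact Or.inl (key u v hd)
  · exact Or.inr fun x h1 h2 => key v u hd x h2 h1

theorem nst_ext {V : Type} [Fintype V] [Nonempty V] {G : SimpleGraph V} (h : Nst G) :
    ∃ (v0 : V) (x : Bool), ∀ u, u ≠ v0 → (G.Adj v0 u ↔ x = true) := by
  classical
  obtain ⟨u, hu⟩ := Finite.exists_max (dg G)
  by_cases hdom : ∀ z, z ≠ u → G.Adj u z
  · exact ⟨u, true, fun z hz => by simp [hdom z hz]⟩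
  push Not at hdom
  obtain ⟨z, hzu, hz⟩ := hdom
  refine ⟨z, false, fun y hyz => ?_⟩
  simp only [Bool.false_eq_true, iff_false]
  intro hzy
  have hyu : y ≠ u := by rintro rfl; exact hz hzy.symm
  rcases h u y with h1 | h1
  · exact hz (h1 z hzu hyz.symm hzy.symm)
  · have hlt : dg G u < dg G y := by
      by_cases huy : G.Adj u y
      · have hs : insert z (insert u (G.neighborSet u \ {y})) ⊆ G.neighborSet y := by
          intro a ha
          simp only [Set.mem_insert_iff, Set.mem_diff, SimpleGraph.mem_neighborSet,
            Set.mem_singleton_iff] at ha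
          rcases ha with rfl | rfl | ⟨ha, hb⟩
          · exact hzy.symm
          · exact huy.symm
          · exact h1 a (G.ne_of_adj ha).symm hb ha
        have := Set.ncard_le_ncard hs
        rw [Set.ncard_insert_of_notMem, Set.ncard_insert_of_notMem,
          Set.ncard_diff_singleton_add_one (show y ∈ G.neighborSet u from huy)] at this
        · exact this
        · simp
        · simp [hzu, hz]
      · have hs : insert z (G.neighborSet u) ⊆ G.neighborSet y := by
          intro a ha
          simp only [Set.mem_insert_iff, SimpleGraph.mem_neighborSet] at ha
          rcases ha with rfl | ha
          · exact hzy.symm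
          · exact h1 a (G.ne_of_adj ha).symm (by rintro rfl; exact huy ha) ha
        have := Set.ncard_le_ncard hs
        rw [Set.ncard_insert_of_notMem (by simpa using hz)] at this
        exact this
    exact absurd (hu y) (not_le.mpr hlt)

open Classical in
theorem nst_isW (n : ℕ) : ∀ (V : Type) [Fintype V] (G : SimpleGraph V), Nat.card V = n + 1 →
    Nst G → ∃ w : List Bool, w.length = n ∧ IsW w V G := by
  induction n with
  | zero => intro V _ G h _; exact ⟨[], rfl, h⟩
  | succ n ih =>
    intro V _ G h hn
    have : Nonempty V := by
      rw [Nat.card_eq_fintype_card] at h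
      exact Fintype.card_pos_iff.mp (by omega)
    obtain ⟨v0, x, hx⟩ := nst_ext hn
    have hc : Nat.card {u : V // u ≠ v0} = n + 1 := by
      rw [Nat.card_eq_fintype_card] at *
      rw [Fintype.card_subtype_compl]; simp [h]
    obtain ⟨w, hw, hW⟩ := ih {u : V // u ≠ v0} (G.comap Subtype.val) hc (by
      intro a b
      rcases hn a b with h1 | h1
      · exact Or.inl fun y h2 h3 => h1 y (fun h => h2 (Subtype.ext h)) (fun h => h3 (Subtype.ext h))
      · exact Or.inr fun y h2 h3 => h1 y (fun h => h2 (Subtype.ext h)) (fun h => h3 (Subtype.ext h)))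
    exact ⟨x :: w, by simp [hw], v0, hx, hW⟩

theorem isW_H (w : List Bool) (V : Type) [Fintype V] (G : SimpleGraph V) (h : IsW w V G) :
    Hval G = wH w := by
  obtain ⟨-, -, -, ⟨t, h1, h2⟩, -⟩ := isW_num w V G h
  have : M2 G = t := by
    have : M2 G = S2 G / 2 := rfl
    rw [this, h1]; omega
  rw [Hval, this, ← h2]; rfl

theorem exists_edges (n m : ℕ) (hm : m ≤ n.choose 2) :
    ∃ G : SimpleGraph (Fin n), edgeCount G = m := by
  classical
  have hc : (⊤ : SimpleGraph (Fin n)).edgeFinset.card = n.choose 2 := by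
    rw [SimpleGraph.card_edgeFinset_top_eq_card_choose_two]; simp
  obtain ⟨t, ht, hcard⟩ := Finset.exists_subset_card_eq (hm.trans hc.ge)
  refine ⟨SimpleGraph.fromEdgeSet (t : Set (Sym2 (Fin n))), ?_⟩
  rw [edgeCount, SimpleGraph.edgeSet_fromEdgeSet]
  have : (t : Set (Sym2 (Fin n))) \ Sym2.diagSet = t := by
    rw [sdiff_eq_left, Set.disjoint_left]
    intro e he hd
    have := ht he
    rw [SimpleGraph.mem_edgeFinset] at this
    exact SimpleGraph.not_isDiag_of_mem_edgeSet _ this hd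
  rw [this, Set.ncard_coe_finset, hcard]

theorem main_aux (n m : ℕ) (hn : 1 ≤ n) (hm : m ≤ n.choose 2) :
    ∃ G : SimpleGraph (Fin n), HOptimal m G ∧
      ∀ G' : SimpleGraph (Fin n), HOptimal m G' → Nonempty (G ≃g G') := by
  classical
  obtain ⟨N, rfl⟩ := Nat.exists_eq_add_of_le hn
  obtain ⟨G0, h0⟩ := exists_edges _ _ hm
  obtain ⟨G1, hG1, hmax1⟩ := Set.exists_max_image {G : SimpleGraph (Fin (1 + N)) | edgeCount G = m} M1
    (Set.toFinite _) ⟨G0, h0⟩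
  have hM1 : MOptimal m G1 := ⟨hG1, hmax1⟩
  obtain ⟨G, hG, hmax⟩ := Set.exists_max_image {G : SimpleGraph (Fin (1 + N)) | MOptimal m G} Hval
    (Set.toFinite _) ⟨G1, hM1⟩
  refine ⟨G, ⟨hG, hmax⟩, ?_⟩
  have key : ∀ G : SimpleGraph (Fin (1 + N)), HOptimal m G →
      ∃ w : List Bool, w.length = N ∧ IsW w _ G ∧ wm w = m ∧ WHmax w := by
    intro G hG
    obtain ⟨w, hw, hW⟩ := nst_isW N _ G (by simp; ring) (nst_of_opt hG.1)
    have hnum := isW_num w _ G hW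
    have hwm : wm w = m := by rw [← hnum.2.1, hG.1.1]
    have real : ∀ v : List Bool, v.length = w.length → wm v = wm w →
        ∃ G' : SimpleGraph (Fin (1 + N)), edgeCount G' = m ∧ (M1 G' : ℤ) = wM v ∧ Hval G' = wH v := by
      intro v hv hvm
      obtain ⟨G', hG'⟩ := isW_exists v (Fin (1 + N)) (by simp; omega)
      have hnum' := isW_num v _ G' hG'
      refine ⟨G', ?_, hnum'.2.2.1, isW_H v _ G' hG'⟩
      have : (edgeCount G' : ℤ) = m := by rw [hnum'.2.1, hvm, hwm]
      exact_mod_cast this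
    have hopt : WOpt w := by
      intro v hv hvm
      obtain ⟨G', h1, h2, -⟩ := real v hv hvm
      rw [← h2, ← hnum.2.2.1]
      exact_mod_cast hG.1.2 G' h1
    refine ⟨w, hw, hW, hwm, hopt, fun v hv hvm hov => ?_⟩
    obtain ⟨G', h1, h2, h3⟩ := real v hv hvm
    rw [← h3, ← isW_H w _ G hW]
    refine hG.2 G' ⟨h1, fun G'' h'' => ?_⟩
    have hle := hG.1.2 G'' h''
    have : (M1 G' : ℤ) = M1 G := by rw [h2, wopt_M hopt hov hv hvm, hnum.2.2.1]
    have : M1 G' = M1 G := by exact_mod_cast this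
    omega
  intro G' hG'
  obtain ⟨w, h1, h2, h3, h4⟩ := key G ⟨hG, hmax⟩
  obtain ⟨w', h1', h2', h3', h4'⟩ := key G' hG'
  have := WT w w' (h1.trans h1'.symm) (h3.trans h3'.symm) h4 h4'
  subst this
  exact isW_iso w _ _ G G' h2 h2'

theorem stmt3 (n m : ℕ) (hn : 1 ≤ n) (hm : m ≤ n.choose 2) :
    ∃ G : SimpleGraph (Fin n), HOptimal m G ∧
      ∀ G' : SimpleGraph (Fin n), HOptimal m G' → Nonempty (G ≃g G') := by
  exact main_aux n m hn hm
end

section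
/- Let n and m be integers such that T_{n,m} (two-terminal graphs on a fixed labeled vertex set of size n with m edges) is nonempty. Define T_{n,m}^{(0)} = T_{n,m} and, for i ∈ {1,…,m}, T_{n,m}^{(i)} = {G ∈ T_{n,m}^{(i−1)} : N_i(G) ≥ N_i(H) for each H ∈ T_{n,m}^{(i−1)}}. Then the set of all locally most reliable two-terminal graphs in T_{n,m} is nonempty and equals T_{n,m}^{(m)}. -/
theorem aux_lt {n m : ℕ} (G H : TwoTerminalGraph n) (k : ℕ) (hk1 : 1 ≤ k) (hkm : k ≤ m)
    (heq : ∀ j, 1 ≤ j → j < k → Ncoeff G j = Ncoeff H j) (hlt : Ncoeff H k < Ncoeff G k) :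
    ∃ δ > 0, ∀ p ∈ Set.Ioo (0:ℝ) δ, relia m H p < relia m G p := by
  let g : ℝ → ℝ := fun p => ∑ i ∈ Finset.Icc k m,
    ((Ncoeff G i : ℝ) - Ncoeff H i) * p ^ (i - k) * (1 - p) ^ (m - i)
  have hg : Continuous g := by fun_prop
  have hg0 : 0 < g 0 := by
    have : g 0 = (Ncoeff G k : ℝ) - Ncoeff H k := by
      simp only [g]
      rw [Finset.sum_eq_single k]
      · simp
      · intro b hb hbk
        have : b - k ≠ 0 := by
          have := (Finset.mem_Icc.mp hb).1
          omega
        simp [this]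
      · intro h
        exact absurd (Finset.mem_Icc.mpr ⟨le_rfl, hkm⟩) h
    rw [this, sub_pos]
    exact_mod_cast hlt
  have hfac : ∀ p, relia m G p - relia m H p = p ^ k * g p := by
    intro p
    simp only [relia, g]
    rw [← Finset.sum_sub_distrib, Finset.mul_sum]
    symm
    have hsub : Finset.Icc k m ⊆ Finset.Icc 1 m := Finset.Icc_subset_Icc hk1 le_rfl
    rw [← Finset.sum_subset hsub (f := fun i => (Ncoeff G i : ℝ) * p ^ i * (1 - p) ^ (m - i)
      - (Ncoeff H i : ℝ) * p ^ i * (1 - p) ^ (m - i))]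
    · apply Finset.sum_congr rfl
      intro i hi
      have : p ^ i = p ^ k * p ^ (i - k) := by
        rw [← pow_add]
        congr 1
        have := (Finset.mem_Icc.mp hi).1
        omega
      rw [this]
      ring
    · intro i hi hi2
      simp only [Finset.mem_Icc] at hi hi2
      rw [heq i hi.1 (by omega)]
      ring
  have hev : ∀ᶠ p in nhds (0:ℝ), 0 < g p := hg.continuousAt.eventually (lt_mem_nhds hg0)
  obtain ⟨δ, hδ, h⟩ := Metric.eventually_nhds_iff.mp hev
  refine ⟨δ, hδ, fun p hp => ?_⟩
  have h1 : 0 < g p := h (by rw [Real.dist_eq, sub_zero, abs_of_pos hp.1]; exact hp.2)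
  have h2 := mul_pos (pow_pos hp.1 k) h1
  have h3 := hfac p
  linarith

theorem aux_sub {n m : ℕ} {i j : ℕ} (h : i ≤ j) : TTfilter n m j ⊆ TTfilter n m i := by
  induction h with
  | refl => exact subset_rfl
  | step _ ih => exact fun x hx => ih hx.1

theorem aux_eq {n m : ℕ} {i : ℕ} {G H : TwoTerminalGraph n} (hG : G ∈ TTfilter n m i)
    (hH : H ∈ TTfilter n m i) (j : ℕ) (h1 : 1 ≤ j) (hj : j ≤ i) : Ncoeff G j = Ncoeff H j := by
  obtain ⟨j, rfl⟩ : ∃ k, j = k + 1 := ⟨j - 1, by omega⟩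
  have a := aux_sub hj hG
  have b := aux_sub hj hH
  exact le_antisymm (b.2 G a.1) (a.2 H b.1)

theorem aux_ne {n m : ℕ} (hne : (TT n m).Nonempty) (i : ℕ) : (TTfilter n m i).Nonempty := by
  induction i with
  | zero => exact hne
  | succ i ih =>
    have hf : ((fun G => Ncoeff G (i+1)) '' TTfilter n m i).Finite := by
      apply (Set.finite_Iic (Nat.card (Set (Sym2 (Fin n))))).subset
      rintro _ ⟨G, _, rfl⟩
      exact Set.ncard_le_card _
    obtain ⟨_, ⟨G, hG, rfl⟩, hmax⟩ := Set.exists_max_image _ id hf (ih.image _)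
    exact ⟨G, hG, fun H hH => hmax _ ⟨H, hH, rfl⟩⟩

theorem aux_strict {n m : ℕ} {G H : TwoTerminalGraph n} (hG : G ∈ TTfilter n m m)
    (hH : H ∈ TT n m) (hn : H ∉ TTfilter n m m) :
    ∃ δ > 0, ∀ p ∈ Set.Ioo (0:ℝ) δ, relia m H p < relia m G p := by
  classical
  have hex : ∃ k, H ∉ TTfilter n m k := ⟨m, hn⟩
  obtain ⟨k, hk, hmin⟩ : ∃ k, H ∉ TTfilter n m k ∧ ∀ j < k, H ∈ TTfilter n m j :=
    ⟨Nat.find hex, Nat.find_spec hex, fun j hj => not_not.mp (Nat.find_min hex hj)⟩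
  have hkm : k ≤ m := by
    by_contra h
    exact hn (hmin m (by omega))
  cases k with
  | zero => exact absurd hH hk
  | succ k =>
    have hHk := hmin k (by omega)
    have hGk : G ∈ TTfilter n m (k+1) := aux_sub hkm hG
    refine aux_lt G H (k+1) (by omega) hkm
      (fun j h1 hj => aux_eq hGk.1 hHk j h1 (by omega)) ?_
    by_contra hc
    exact hk ⟨hHk, fun K hK => (hGk.2 K hK).trans (not_lt.mp hc)⟩

theorem stmt5 (n m : ℕ) (hne : (TT n m).Nonempty) :
    {G : TwoTerminalGraph n | IsLMRTTG n m G}.Nonempty ∧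
      {G : TwoTerminalGraph n | IsLMRTTG n m G} = TTfilter n m m := by
  have key : {G : TwoTerminalGraph n | IsLMRTTG n m G} = TTfilter n m m := by
    ext G
    constructor
    · rintro ⟨hG, hall⟩
      by_contra hn
      obtain ⟨H, hH⟩ := aux_ne hne m
      obtain ⟨δ, hδ, h⟩ := aux_strict hH hG hn
      obtain ⟨ε, hε, h'⟩ := hall H (aux_sub (Nat.zero_le m) hH)
      have hpos : 0 < min δ ε := lt_min hδ hε
      have hl := min_le_left δ ε
      have hr := min_le_right δ ε
      have a := h (min δ ε / 2) ⟨by linarith, by linarith⟩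
      have b := h' (min δ ε / 2) ⟨by linarith, by linarith⟩
      linarith
    · intro hG
      refine ⟨aux_sub (Nat.zero_le m) hG, fun H hH => ?_⟩
      by_cases hm : H ∈ TTfilter n m m
      · refine ⟨1, one_pos, fun p _ => le_of_eq ?_⟩
        unfold relia
        apply Finset.sum_congr rfl
        intro i hi
        rw [aux_eq hG hm i (Finset.mem_Icc.mp hi).1 (Finset.mem_Icc.mp hi).2]
      · obtain ⟨δ, hδ, h⟩ := aux_strict hG hH hm
        exact ⟨δ, hδ, fun p hp => (h p hp).le⟩
  exact ⟨key ▸ aux_ne hne m, key⟩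
end

section
/- Let n and m be integers with n ≥ 5 and 0 ≤ m ≤ C(n,2), and let G be any simple graph on n vertices with m edges, with complement Ḡ. Then H(G) + H(Ḡ) = (n − 9/2)·M₁(G) + h(n,m), where h(n,m) = 2m² − 6·C(n,3) + (n−1)²·C(n,2) − 3(n−1)(n−3)·m. -/
open Classical in
noncomputable def adjQ {n : ℕ} (G : SimpleGraph (Fin n)) (u v : Fin n) : ℚ :=
  if G.Adj u v then 1 else 0

lemma ncard_nbr {n : ℕ} (G : SimpleGraph (Fin n)) (u : Fin n) :
    ((G.neighborSet u).ncard : ℚ) = ∑ v, adjQ G u v := by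
  classical
  simp only [adjQ, Finset.sum_boole]
  rw [Set.ncard_eq_toFinset_card']
  congr 2
  ext v; simp

lemma sum_symm_half {n : ℕ} (f : Fin n → Fin n → ℕ) (hs : ∀ u v, f u v = f v u)
    (h0 : ∀ u, f u u = 0) :
    ∑ u, ∑ v, f u v = 2 * ∑ u, ∑ v, (if u < v then f u v else 0) := by
  have h : ∑ u, ∑ v, (if u < v then f u v else 0) = ∑ u, ∑ v, (if v < u then f u v else 0) := by
    rw [Finset.sum_comm]
    refine Finset.sum_congr rfl fun u _ => Finset.sum_congr rfl fun v _ => ?_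
    rw [hs]
  rw [two_mul]
  nth_rewrite 2 [h]
  simp only [← Finset.sum_add_distrib]
  refine Finset.sum_congr rfl fun u _ => Finset.sum_congr rfl fun v _ => ?_
  rcases lt_trichotomy u v with h | h | h
  · simp [h, h.not_gt]
  · subst h; simp [h0]
  · simp [h, h.not_gt]

lemma M2_eq {n : ℕ} (G : SimpleGraph (Fin n)) :
    2 * (M2 G : ℚ) = ∑ u, ∑ v, adjQ G u v * ((∑ w, adjQ G u w) * (∑ w, adjQ G v w)) := by
  classical
  have h := sum_symm_half (fun u v => 
    if G.Adj u v then (G.neighborSet u).ncard * (G.neighborSet v).ncard else 0)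
    (by intro u v; simp only [G.adj_comm u v, mul_comm]) (by simp)
  have h2 : 2 * M2 G = ∑ u, ∑ v, 
    if G.Adj u v then (G.neighborSet u).ncard * (G.neighborSet v).ncard else 0 := by
    have : M2 G = (∑ u, ∑ v, 
      if G.Adj u v then (G.neighborSet u).ncard * (G.neighborSet v).ncard else 0) / 2 := by
      unfold M2
      congr!
    rw [this]
    omega
  have h3 : 2 * (M2 G : ℚ) = ((2 * M2 G : ℕ) : ℚ) := by push_cast; rfl
  rw [h3, h2]
  push_cast
  refine Finset.sum_congr rfl fun u _ => Finset.sum_congr rfl fun v _ => ?_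
  rw [← ncard_nbr, ← ncard_nbr]
  simp [adjQ]

lemma edge_eq {n : ℕ} (G : SimpleGraph (Fin n)) :
    2 * (edgeCount G : ℚ) = ∑ u, ∑ v, adjQ G u v := by
  classical
  have h := G.sum_degrees_eq_twice_card_edges
  have h1 : edgeCount G = G.edgeFinset.card := by
    unfold edgeCount
    rw [Set.ncard_eq_toFinset_card']
    rfl
  rw [h1]
  have : (2 * G.edgeFinset.card : ℚ) = ((2 * G.edgeFinset.card : ℕ) : ℚ) := by push_cast; rfl
  rw [this, ← h]
  push_cast
  refine Finset.sum_congr rfl fun u _ => ?_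
  rw [← ncard_nbr, Set.ncard_eq_toFinset_card']
  rfl

lemma k3_eq {n : ℕ} (G : SimpleGraph (Fin n)) :
    6 * (k3 G : ℚ) = ∑ u, ∑ v, ∑ w, adjQ G u v * adjQ G v w * adjQ G u w := by
  classical
  have h1 : k3 G = (G.cliqueFinset 3).card := by
    unfold k3
    rw [Set.ncard_eq_toFinset_card']
    congr 1
    ext s; simp [SimpleGraph.mem_cliqueFinset_iff]
  set T : Finset (Fin n × Fin n × Fin n) :=
    Finset.univ.filter fun p => G.Adj p.1 p.2.1 ∧ G.Adj p.2.1 p.2.2 ∧ G.Adj p.1 p.2.2 with hT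
  have h2 : T.card = ∑ s ∈ G.cliqueFinset 3,
      (T.filter fun p => ({p.1, p.2.1, p.2.2} : Finset (Fin n)) = s).card := by
    apply Finset.card_eq_sum_card_fiberwise
    intro p hp
    simp only [hT, Finset.coe_filter, Finset.mem_univ, true_and, Set.mem_ofPred_eq] at hp
    simp only [Finset.mem_coe, SimpleGraph.mem_cliqueFinset_iff]
    rw [SimpleGraph.is3Clique_triple_iff]
    exact ⟨hp.1, hp.2.2, hp.2.1⟩
  have h3 : ∀ s ∈ G.cliqueFinset 3,
      (T.filter fun p => ({p.1, p.2.1, p.2.2} : Finset (Fin n)) = s).card = 6 := by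
    intro s hs
    rw [SimpleGraph.mem_cliqueFinset_iff, SimpleGraph.is3Clique_iff] at hs
    obtain ⟨x, y, z, hxy, hxz, hyz, rfl⟩ := hs
    have nxy := hxy.ne
    have nxz := hxz.ne
    have nyz := hyz.ne
    have : (T.filter fun p => ({p.1, p.2.1, p.2.2} : Finset (Fin n)) = {x, y, z}) =
        {(x,y,z), (x,z,y), (y,x,z), (y,z,x), (z,x,y), (z,y,x)} := by
      ext ⟨a, b, c⟩
      simp only [hT, Finset.mem_filter, Finset.mem_univ, true_and, Finset.mem_insert,
        Finset.mem_singleton, Prod.mk.injEq]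
      constructor
      · rintro ⟨⟨hab, hbc, hac⟩, he⟩
        have nab := hab.ne
        have nac := hac.ne
        have nbc := hbc.ne
        have ha : a ∈ ({x, y, z} : Finset (Fin n)) := by rw [← he]; simp
        have hb : b ∈ ({x, y, z} : Finset (Fin n)) := by rw [← he]; simp
        have hc : c ∈ ({x, y, z} : Finset (Fin n)) := by rw [← he]; simp
        simp only [Finset.mem_insert, Finset.mem_singleton] at ha hb hc
        clear he hT
        grind
      · have := hxy.symm
        have := hxz.symm
        have := hyz.symm
        rintro (⟨rfl, rfl, rfl⟩ | ⟨rfl, rfl, rfl⟩ | ⟨rfl, rfl, rfl⟩ | ⟨rfl, rfl, rfl⟩ |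
          ⟨rfl, rfl, rfl⟩ | ⟨rfl, rfl, rfl⟩) <;> 
        refine ⟨⟨by assumption, by assumption, by assumption⟩, ?_⟩ <;> ext t <;>
        simp only [Finset.mem_insert, Finset.mem_singleton] <;> tauto
    rw [this]
    simp [nxy, nxz, nyz, nxy.symm, nxz.symm, nyz.symm]
  rw [Finset.sum_congr rfl h3] at h2
  rw [Finset.sum_const, smul_eq_mul, ← h1] at h2
  have h4 : (T.card : ℚ) = ∑ u, ∑ v, ∑ w, adjQ G u v * adjQ G v w * adjQ G u w := by
    rw [hT, Finset.card_filter, Fintype.sum_prod_type]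
    simp only [Fintype.sum_prod_type]
    push_cast
    refine Finset.sum_congr rfl fun u _ => Finset.sum_congr rfl fun v _ =>
      Finset.sum_congr rfl fun w _ => ?_
    simp only [adjQ]
    split_ifs <;> simp_all
  rw [← h4, h2]
  push_cast
  ring

def dlt {n : ℕ} (u v : Fin n) : ℚ := if u = v then 1 else 0

lemma adj_compl {n : ℕ} (G : SimpleGraph (Fin n)) (u v : Fin n) :
    adjQ Gᶜ u v = 1 - dlt u v - adjQ G u v := by
  classical
  simp only [adjQ, dlt, SimpleGraph.compl_adj]
  by_cases h : u = v
  · subst h; simp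
  · by_cases h' : G.Adj u v <;> simp [h, h']

lemma adj_symm {n : ℕ} (G : SimpleGraph (Fin n)) (u v : Fin n) :
    adjQ G u v = adjQ G v u := by
  unfold adjQ
  congr 1
  exact propext (G.adj_comm u v)

lemma pt {n : ℕ} (G : SimpleGraph (Fin n)) (u v w : Fin n) :
    adjQ G u v * adjQ G v w * adjQ G u w + adjQ Gᶜ u v * adjQ Gᶜ v w * adjQ Gᶜ u w =
     1 - dlt u v - dlt v w - dlt u w + 2 * (dlt u v * dlt v w)
     - adjQ G u v * (1 - dlt v w - dlt u w)
     - adjQ G v w * (1 - dlt u v - dlt u w)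
     - adjQ G u w * (1 - dlt u v - dlt v w)
     + (adjQ G v u * adjQ G v w - dlt u w * adjQ G u v)
     + (adjQ G u v * adjQ G u w - dlt v w * adjQ G u v)
     + (adjQ G w u * adjQ G w v - dlt u v * adjQ G u w) := by
  classical
  simp only [adj_compl]
  have hs := adj_symm G
  have h0 : ∀ x, adjQ G x x = 0 := by intro x; simp [adjQ]
  have hi : ∀ x y, adjQ G x y * adjQ G x y = adjQ G x y := by
    intro x y; simp [adjQ]
  rw [hs v u, hs w u, hs w v]
  by_cases h1 : u = v
  · subst h1
    by_cases h2 : u = w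
    · subst h2; simp [dlt, h0]; norm_num
    · simp [dlt, h0, h2]; linear_combination -hi u w
  · by_cases h2 : u = w
    · subst h2; simp [dlt, h0, h1, Ne.symm h1, hs v u]; linear_combination -hi u v
    · by_cases h3 : v = w
      · subst h3; simp [dlt, h0, h1]; linear_combination -hi u v
      · simp [dlt, h1, h2, h3]; ring

lemma tri {n : ℕ} (G : SimpleGraph (Fin n)) :
    6 * (k3 G : ℚ) + 6 * (k3 Gᶜ : ℚ) = n * (n - 1) * (n - 2) - 6 * edgeCount G * (n - 2)
      + 3 * (M1 G - 2 * edgeCount G) := by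
  have hM : (M1 G : ℚ) = ∑ u, (∑ v, adjQ G u v) * (∑ v, adjQ G u v) := by
    unfold M1; push_cast; simp only [ncard_nbr, sq]
  have hE := edge_eq G
  have hE' : 2 * (edgeCount G : ℚ) = ∑ u, ∑ v, adjQ G v u := by
    rw [hE]; exact Finset.sum_comm
  rw [k3_eq, k3_eq]
  simp only [← Finset.sum_add_distrib]
  simp only [pt]
  have e1 : ∑ u, ∑ v, ∑ w, adjQ G v u * adjQ G v w = (M1 G : ℚ) := by
    rw [Finset.sum_comm, hM]
    simp only [Finset.sum_mul_sum]
  have e2 : ∑ u, ∑ v, ∑ w, adjQ G u v * adjQ G u w = (M1 G : ℚ) := by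
    rw [hM]
    simp only [Finset.sum_mul_sum]
  have e3 : ∑ u, ∑ v, ∑ w, adjQ G w u * adjQ G w v = (M1 G : ℚ) := by
    rw [hM]
    simp only [Finset.sum_mul_sum]
    have : ∀ u : Fin n, ∑ v, ∑ w, adjQ G w u * adjQ G w v = ∑ w, ∑ v, adjQ G w u * adjQ G w v :=
      fun v => Finset.sum_comm
    simp only [this]
    exact Finset.sum_comm
  have e4 : ∑ u : Fin n, ∑ w, ∑ v : Fin n, adjQ G w v = n * (2 * (edgeCount G : ℚ)) := by
    rw [← hE]; simp
  have e5 : ∑ u : Fin n, ∑ v : Fin n, ∑ w, adjQ G u w = n * (2 * (edgeCount G : ℚ)) := by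
    rw [hE]; simp [Finset.mul_sum]
  have e6 : ∑ u : Fin n, ∑ v : Fin n, ∑ w : Fin n, adjQ G u v = n * (2 * (edgeCount G : ℚ)) := by
    rw [hE]; simp [Finset.mul_sum]
  simp only [mul_sub, mul_one, Finset.sum_add_distrib, Finset.sum_sub_distrib, e1, e2, e3, e4, e5, e6]
  simp [dlt, ← hE, ← hE']
  ring

lemma M2_sum {n : ℕ} (G : SimpleGraph (Fin n)) :
    2 * (M2 G : ℚ) + 2 * (M2 Gᶜ : ℚ) = 2 * (((n:ℚ) - 3/2) * M1 G + 2 * (edgeCount G : ℚ)^2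
     + (n-1)^2 * (n * (n-1) / 2) - 3 * (n-1)^2 * edgeCount G) := by
  have hM : (M1 G : ℚ) = ∑ u, (∑ v, adjQ G u v) ^ 2 := by
    unfold M1; push_cast; simp only [ncard_nbr]
  have hE := edge_eq G
  rw [M2_eq, M2_eq]
  have hc : ∀ u, ∑ w, adjQ Gᶜ u w = n - 1 - ∑ w, adjQ G u w := by
    intro u; simp [adj_compl, dlt]
  simp only [hc]
  simp only [adj_compl]
  have hpt : ∀ u v : Fin n, ∀ d e : ℚ, adjQ G u v * (d * e) +
      (1 - dlt u v - adjQ G u v) * ((n - 1 - d) * (n - 1 - e)) =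
      (n-1)^2 - (n-1) * d - (n-1) * e + d * e - dlt u v * ((n - 1 - d) * (n - 1 - e))
      - (n-1)^2 * adjQ G u v + (n-1) * (adjQ G u v * d) + (n-1) * (adjQ G u v * e) := by
    intros; ring
  simp only [← Finset.sum_add_distrib]
  simp only [hpt]
  have f1 : ∑ u, ∑ v, adjQ G u v * ∑ w, adjQ G u w = (M1 G : ℚ) := by
    rw [hM]; simp only [← Finset.sum_mul, sq]
  have f2 : ∑ u, ∑ v, adjQ G u v * ∑ w, adjQ G v w = (M1 G : ℚ) := by
    rw [Finset.sum_comm, ← f1]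
    refine Finset.sum_congr rfl fun u _ => Finset.sum_congr rfl fun v _ => ?_
    rw [adj_symm G v u]
  have f3 : ∑ u : Fin n, ∑ v, (∑ w, adjQ G u w) * ∑ w, adjQ G v w
      = (2 * (edgeCount G : ℚ)) ^ 2 := by
    rw [hE, sq, Finset.sum_mul_sum]
  have f4 : ∑ u : Fin n, ∑ v : Fin n, dlt u v *
      (((n:ℚ) - 1 - ∑ w, adjQ G u w) * (n - 1 - ∑ w, adjQ G v w))
      = n * (n-1)^2 - 2 * (n-1) * (2 * edgeCount G) + M1 G := by
    have : ∀ d : ℚ, ((n:ℚ) - 1 - d) * (n - 1 - d) = (n-1)^2 - 2 * (n-1) * d + d^2 := by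
      intro d; ring
    simp only [dlt, ite_mul, one_mul, zero_mul, Finset.sum_ite_eq, Finset.mem_univ, if_true, this]
    rw [hE, hM]
    simp only [Finset.sum_add_distrib, Finset.sum_sub_distrib, ← Finset.mul_sum]
    simp
  simp only [Finset.sum_add_distrib, Finset.sum_sub_distrib, ← Finset.mul_sum, f1, f2, f4, ← hE]
  simp only [Finset.sum_const, Finset.card_univ, Fintype.card_fin, nsmul_eq_mul, ← Finset.mul_sum, ← Finset.sum_mul, ← hE]
  ring

theorem stmt7 (n m : ℕ) (hn : 5 ≤ n) (hm : m ≤ n.choose 2)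
    (G : SimpleGraph (Fin n)) (hG : edgeCount G = m) :
    (Hval G : ℚ) + (Hval Gᶜ : ℚ) = ((n : ℚ) - 9/2) * (M1 G : ℚ) +
      (2*(m:ℚ)^2 - 6*((n.choose 3 : ℕ) : ℚ) + ((n:ℚ) - 1)^2 * ((n.choose 2 : ℕ) : ℚ)
        - 3*((n:ℚ) - 1)*((n:ℚ) - 3)*(m:ℚ)) := by
  have h1 := M2_sum G
  have h2 := tri G
  rw [hG] at h1 h2
  have c2 : ((n.choose 2 : ℕ) : ℚ) = n * (n - 1) / 2 := Nat.cast_choose_two ℚ n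
  have c3 : 6 * ((n.choose 3 : ℕ) : ℚ) = n * (n - 1) * (n - 2) := by
    obtain ⟨k, rfl⟩ : ∃ k, n = k + 3 := ⟨n - 3, by omega⟩
    have := Nat.add_choose_mul_factorial_mul_factorial k 3
    have h := Nat.descFactorial_eq_factorial_mul_choose (k + 3) 3
    simp [Nat.descFactorial, Nat.factorial] at h
    have h' : (((k + 1) * ((k + 2) * (k + 3)) : ℕ) : ℚ) = ((6 * (k + 3).choose 3 : ℕ) : ℚ) := by
      congr 1
    push_cast at h' ⊢
    linarith
  unfold Hval
  push_cast
  rw [c2, c3]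
  linear_combination h1 / 2 - h2
end

section
/- Let n and m be integers with n ≥ 1 and 0 ≤ m ≤ C(n,2), and let k, j be the unique integers with 1 ≤ j ≤ k and m = C(k+1,2) − j. Then H(C¹_{n,m}) = (1/2)k⁴ − (1/2)k³ − 3jk² + (j² + 7j + 1)k − (5j² + 7j)/2. -/
def qA (a k u v : ℕ) : Prop := u ≠ v ∧ ((u < k ∧ v < k) ∨ (u = k ∧ v < a) ∨ (v = k ∧ u < a))

instance (a k u v : ℕ) : Decidable (qA a k u v) := by unfold qA; infer_instance

def qd (a k i : ℕ) : ℤ := if i < a then k else if i < k then k - 1 else if i = k then a else 0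

lemma qadj (n k j : ℕ) (u v : Fin n) :
    (quasiComplete n k j).Adj u v ↔ qA (k - j) k u.val v.val := by
  unfold quasiComplete qA
  rw [SimpleGraph.fromRel_adj]
  rw [Ne, Fin.ext_iff]
  constructor <;> (rintro ⟨h1, h2⟩; refine ⟨h1, ?_⟩; tauto)

lemma qsum (n k : ℕ) (f : ℕ → ℤ) (h : ∀ i, k < i → f i = 0)
    (h2 : k + 1 ≤ n ∨ (k ≤ n ∧ f k = 0)) :
    ∑ v : Fin n, f v.val = ∑ i ∈ Finset.range (k+1), f i := by
  rw [Fin.sum_univ_eq_sum_range]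
  rcases h2 with h2 | ⟨h2, h3⟩
  · symm
    apply Finset.sum_subset
    · intro x; simp; omega
    · intro x _ hx; apply h; simpa using hx
  · rw [Finset.sum_range_succ, h3, add_zero]
    symm
    apply Finset.sum_subset
    · intro x; simp; omega
    · intro x _ hx
      simp at hx
      rcases eq_or_lt_of_le hx with rfl | hx
      · exact h3
      · exact h _ hx

lemma qinner1 (a k u : ℕ) (f : ℕ → ℤ) (hu : u < k) :
    ∑ v ∈ Finset.range (k+1), (if qA a k u v then f v else 0)
      = ∑ v ∈ Finset.range k, f v - f u + if u < a then f k else 0 := by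
  rw [Finset.sum_range_succ]
  congr 1
  · rw [eq_sub_iff_add_eq]
    have : f u = ∑ v ∈ Finset.range k, if u = v then f v else 0 := by
      rw [Finset.sum_ite_eq]; simp [hu]
    rw [this, ← Finset.sum_add_distrib]
    apply Finset.sum_congr rfl
    intro v hv
    simp at hv
    by_cases h : u = v
    · simp [qA, h]
    · have : qA a k u v := ⟨h, Or.inl ⟨hu, hv⟩⟩
      simp [this, h]
  · apply if_congr _ rfl rfl
    unfold qA; omega

lemma qinner2 (a k : ℕ) (f : ℕ → ℤ) (ha : a ≤ k) :
    ∑ v ∈ Finset.range (k+1), (if qA a k k v then f v else 0)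
      = ∑ v ∈ Finset.range a, f v := by
  rw [← Finset.sum_filter]
  apply Finset.sum_congr _ (fun _ _ => rfl)
  ext v; simp [qA]; omega

lemma qinner3 (a k u : ℕ) (f : ℕ → ℤ) (hu : k < u) (ha : a ≤ k) :
    ∑ v ∈ Finset.range (k+1), (if qA a k u v then f v else 0) = 0 := by
  apply Finset.sum_eq_zero
  intro v hv
  rw [if_neg]
  unfold qA; omega

lemma qsumd (a b : ℕ) : ∑ v ∈ Finset.range (a+b+1), qd a (a+b+1) v
    = a * (a+b+1) + (b+1) * (a+b) := by
  rw [add_assoc, Finset.sum_range_add]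
  congr 1
  · rw [Finset.sum_congr rfl (g := fun _ => ((a:ℤ)+b+1))]
    · simp
    · intro x hx; simp at hx; simp [qd, hx]; ring
  · rw [Finset.sum_congr rfl (g := fun _ => ((a:ℤ)+b))]
    · simp
    · intro x hx; simp at hx
      unfold qd; rw [if_neg (by omega), if_pos (by omega)]; push_cast; ring

lemma qdeg (n a b : ℕ) (hn : a+b+1+1 ≤ n ∨ (a+b+1 ≤ n ∧ a = 0)) (u : Fin n) :
    (((quasiComplete n (a+b+1) (b+1)).neighborSet u).ncard : ℤ) = qd a (a+b+1) u.val := by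
  classical
  have e : a + b + 1 - (b+1) = a := by omega
  have : (quasiComplete n (a+b+1) (b+1)).neighborSet u
      = ((Finset.univ.filter fun v : Fin n => qA a (a+b+1) u.val v.val : Finset (Fin n)) : Set (Fin n)) := by
    ext v; simp [qadj, e]
  rw [this, Set.ncard_coe_finset, Finset.card_filter]
  push_cast
  rw [qsum n (a+b+1) (fun i => if qA a (a+b+1) u.val i then 1 else 0)]
  · rcases lt_trichotomy u.val (a+b+1) with h | h | h
    · rw [qinner1 _ _ _ (fun _ => 1) h]
      unfold qd
      simp only [h, if_true, Finset.sum_const, Finset.card_range]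
      split_ifs <;> simp
    · rw [h, qinner2 _ _ (fun _ => 1) (by omega)]
      unfold qd
      rw [if_neg (by omega), if_neg (by omega)]; simp
    · rw [qinner3 _ _ _ (fun _ => 1) h (by omega)]
      unfold qd
      rw [if_neg (by omega), if_neg (by omega), if_neg (by omega)]
  · intro i hi
    simp only [ite_eq_right_iff]
    intro h; unfold qA at h; omega
  · rcases hn with h | ⟨h, h'⟩
    · exact Or.inl h
    · right; refine ⟨h, ?_⟩
      simp only [ite_eq_right_iff]
      intro h; unfold qA at h; have := u.2; omega

lemma qM2sum (a b : ℕ) :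
    ∑ u ∈ Finset.range (a+b+1+1), qd a (a+b+1) u * ∑ v ∈ Finset.range (a+b+1+1),
      (if qA a (a+b+1) u v then qd a (a+b+1) v else 0)
    = a*(a-1)*(a+b+1)^2 + 2*a*(b+1)*(a+b+1)*(a+b) + (b+1)*b*(a+b)^2 + 2*a^2*(a+b+1) := by
  have hk : qd a (a+b+1) (a+b+1) = a := by
    unfold qd; rw [if_neg (by omega), if_neg (by omega)]; simp
  have h1 : ∀ u, u < a → qd a (a+b+1) u = a+b+1 := by
    intro u h; simp [qd, h]
  have h2 : ∀ u, ¬ u < a → u < a+b+1 → qd a (a+b+1) u = a+b := by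
    intro u h h'; simp [qd, h, h']
  rw [Finset.sum_range_succ, qinner2 _ _ _ (by omega), hk]
  rw [Finset.sum_congr rfl (g := fun _ => ((a:ℤ)+b+1)) (s₂ := Finset.range a)]
  swap
  · intro x hx; exact h1 x (by simpa using hx)
  rw [add_assoc a b 1, Finset.sum_range_add, ← add_assoc a b 1]
  rw [Finset.sum_congr rfl (s₂ := Finset.range a) (g := fun _ => ((a:ℤ)+b+1) *
    ((a * (a+b+1) + (b+1) * (a+b)) - (a+b+1) + a))]
  swap
  · intro x hx
    have hx : x < a := by simpa using hx
    rw [qinner1 _ _ _ _ (by omega), qsumd, h1 x hx, if_pos hx, hk]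
  rw [Finset.sum_congr rfl (s₂ := Finset.range (b+1)) (g := fun _ => ((a:ℤ)+b) *
    ((a * (a+b+1) + (b+1) * (a+b)) - (a+b)))]
  swap
  · intro x hx
    have hx : x < b+1 := by simpa using hx
    rw [qinner1 _ _ _ _ (by omega), qsumd, h2 (a+x) (by omega) (by omega), if_neg (by omega)]
    ring
  simp only [Finset.sum_const, Finset.card_range, nsmul_eq_mul]
  push_cast
  ring

lemma two_choose (a : ℕ) : 2 * ((a.choose 2 : ℕ) : ℤ) = a * (a - 1) := by
  induction a with
  | zero => simp
  | succ a ih =>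
    rw [Nat.choose_succ_succ' a 1]; push_cast; simp; linarith

lemma six_choose (a : ℕ) : 6 * ((a.choose 3 : ℕ) : ℤ) = a * (a - 1) * (a - 2) := by
  induction a with
  | zero => simp
  | succ a ih =>
    have := two_choose a
    rw [Nat.choose_succ_succ' a 2]; push_cast; linear_combination ih + 3 * this

lemma qM2 (n a b : ℕ) (hn : a+b+1+1 ≤ n ∨ (a+b+1 ≤ n ∧ a = 0)) :
    2 * (M2 (quasiComplete n (a+b+1) (b+1)) : ℤ) =
    a*(a-1)*(a+b+1)^2 + 2*a*(b+1)*(a+b+1)*(a+b) + (b+1)*b*(a+b)^2 + 2*a^2*(a+b+1) := by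
  classical
  have e : a + b + 1 - (b+1) = a := by omega
  unfold M2
  set S := (∑ u : Fin n, ∑ v : Fin n,
    if (quasiComplete n (a+b+1) (b+1)).Adj u v then
      ((quasiComplete n (a+b+1) (b+1)).neighborSet u).ncard *
      ((quasiComplete n (a+b+1) (b+1)).neighborSet v).ncard else 0) with hS
  have key : (S : ℤ) =
     a*(a-1)*(a+b+1)^2 + 2*a*(b+1)*(a+b+1)*(a+b) + (b+1)*b*(a+b)^2 + 2*a^2*(a+b+1) := by
    rw [← qM2sum, hS]
    push_cast
    simp only [qdeg n a b hn, qadj, e]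
    have hz : ∀ i, a+b+1 < i → qd a (a+b+1) i = 0 := by
      intro i hi; unfold qd
      rw [if_neg (by omega), if_neg (by omega), if_neg (by omega)]
    have hk : a = 0 → qd a (a+b+1) (a+b+1) = 0 := by
      intro h; unfold qd
      rw [if_neg (by omega), if_neg (by omega)]; simp [h]
    rw [← qsum n]
    · apply Finset.sum_congr rfl
      intro u _
      rw [← qsum n (a+b+1) (fun v => if qA a (a+b+1) u.val v then qd a (a+b+1) v else 0)]
      · rw [Finset.mul_sum]
        apply Finset.sum_congr rfl
        intro v _
        split_ifs <;> simp
      · intro i hi; simp [hz i hi]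
      · rcases hn with h | ⟨h, h'⟩
        · exact Or.inl h
        · right; exact ⟨h, by simp [hk h']⟩
    · intro i hi; simp [hz i hi]
    · rcases hn with h | ⟨h, h'⟩
      · exact Or.inl h
      · right; exact ⟨h, by simp [hk h']⟩
  have h1 := two_choose a
  have h2 := two_choose (b+1)
  have : (S : ℤ) = 2 * ((a.choose 2 : ℕ) * (a+b+1)^2 + a*(b+1)*(a+b+1)*(a+b)
      + ((b+1).choose 2 : ℕ) * (a+b)^2 + a^2*(a+b+1)) := by
    rw [key]; push_cast at h2
    linear_combination (-(a+b+1:ℤ)^2) * h1 - (a+b:ℤ)^2 * h2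
  have hdiv : 2 ∣ S := by
    have : (2:ℤ) ∣ (S:ℤ) := ⟨_, this⟩
    exact_mod_cast this
  rw [← key]
  have := Nat.mul_div_cancel' hdiv
  exact_mod_cast this

lemma qk3 (n a b : ℕ) (hn : a+b+1+1 ≤ n ∨ (a+b+1 ≤ n ∧ a = 0)) :
    k3 (quasiComplete n (a+b+1) (b+1)) = (a+b+1).choose 3 + a.choose 2 := by
  classical
  have e : a + b + 1 - (b+1) = a := by omega
  have hcard : ∀ t, t ≤ n → (Finset.univ.filter fun v : Fin n => v.val < t).card = t := by
    intro t ht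
    rw [Fin.card_filter_val_lt]; omega
  set A := Finset.univ.filter fun v : Fin n => v.val < a+b+1 with hA
  have cA : A.card = a+b+1 := hcard _ (by omega)
  set B := Finset.univ.filter fun v : Fin n => v.val < a with hB
  have cB : B.card = a := hcard _ (by omega)
  unfold k3
  rcases hn with hn | ⟨hn, ha⟩
  · let w : Fin n := ⟨a+b+1, by omega⟩
    have hwB : w ∉ B := by simp [hB, w]; omega
    have hwA : w ∉ A := by simp [hA, w]
    have hset : {s : Finset (Fin n) | (quasiComplete n (a+b+1) (b+1)).IsNClique 3 s}
        = ((A.powersetCard 3 ∪ (B.powersetCard 2).image (insert w) : Finset (Finset (Fin n))) : Set (Finset (Fin n))) := by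
      ext s
      simp only [Set.mem_setOf_eq, Finset.coe_union, Set.mem_union, Finset.mem_coe,
        Finset.mem_powersetCard, Finset.mem_image, SimpleGraph.isNClique_iff]
      constructor
      · rintro ⟨hc, h3⟩
        have hadj : ∀ x ∈ s, ∀ y ∈ s, x ≠ y → qA a (a+b+1) x.val y.val := by
          intro x hx y hy hxy
          have := hc hx hy hxy
          rwa [qadj, e] at this
        by_cases hw : w ∈ s
        · right
          refine ⟨s.erase w, ⟨?_, ?_⟩, Finset.insert_erase hw⟩
          · intro x hx
            have hx' := Finset.mem_erase.1 hx
            have := hadj x hx'.2 w hw hx'.1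
            simp [hB]
            simp [qA, w] at this; omega
          · rw [Finset.card_erase_of_mem hw, h3]
        · left
          refine ⟨?_, h3⟩
          intro x hx
          obtain ⟨y, hy, hyx⟩ := Finset.exists_mem_ne (by omega : 1 < s.card) x
          have := hadj x hx y hy hyx.symm
          have hxw : x.val ≠ a+b+1 := by
            intro h; apply hw
            have : x = w := Fin.ext h
            rwa [← this]
          have := hadj x hx y hy hyx.symm
          simp [hA]
          unfold qA at this; omega
      · rintro (⟨hs, h3⟩ | ⟨t, ⟨ht, h2⟩, rfl⟩)
        · refine ⟨?_, h3⟩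
          intro x hx y hy hxy
          rw [qadj, e]
          have h1 := hs hx
          have h2 := hs hy
          simp [hA] at h1 h2
          exact ⟨fun h => hxy (Fin.ext h), Or.inl ⟨by omega, by omega⟩⟩
        · refine ⟨?_, ?_⟩
          · have hlt : ∀ x ∈ t, x.val < a := by
              intro x hx; have := ht hx; simpa [hB] using this
            intro x hx y hy hxy
            rw [qadj, e]
            have hne : x.val ≠ y.val := fun h => hxy (Fin.ext h)
            refine ⟨hne, ?_⟩
            simp only [Finset.coe_insert, Set.mem_insert_iff, Finset.mem_coe] at hx hy
            have hx' : x.val = a+b+1 ∨ x.val < a := hx.imp (fun h => by rw [h]) (hlt x)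
            have hy' : y.val = a+b+1 ∨ y.val < a := hy.imp (fun h => by rw [h]) (hlt y)
            omega
          · rw [Finset.card_insert_of_notMem (fun h => hwB (ht h)), h2]
    rw [hset, Set.ncard_coe_finset, Finset.card_union_of_disjoint, Finset.card_image_of_injOn,
      Finset.card_powersetCard, Finset.card_powersetCard, cA, cB]
    · intro s hs t ht hst
      simp only [Finset.mem_coe, Finset.mem_powersetCard] at hs ht
      have h1 : w ∉ s := fun h => hwB (hs.1 h)
      have h2 : w ∉ t := fun h => hwB (ht.1 h)
      rw [← Finset.erase_insert h1, ← Finset.erase_insert h2]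
      exact congrArg (fun z => Finset.erase z w) hst
    · rw [Finset.disjoint_left]
      intro s hs hs'
      simp only [Finset.mem_image, Finset.mem_powersetCard] at hs hs'
      obtain ⟨t, -, rfl⟩ := hs'
      exact hwA (hs.1 (Finset.mem_insert_self _ _))
  · have hset : {s : Finset (Fin n) | (quasiComplete n (a+b+1) (b+1)).IsNClique 3 s}
        = ((A.powersetCard 3 : Finset (Finset (Fin n))) : Set (Finset (Fin n))) := by
      ext s
      simp only [Set.mem_setOf_eq, Finset.mem_coe,
        Finset.mem_powersetCard, SimpleGraph.isNClique_iff]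
      constructor
      · rintro ⟨hc, h3⟩
        refine ⟨?_, h3⟩
        intro x hx
        obtain ⟨y, hy, hyx⟩ := Finset.exists_mem_ne (by omega : 1 < s.card) x
        have := hc hx hy hyx.symm
        rw [qadj, e] at this
        simp [hA]
        unfold qA at this; omega
      · rintro ⟨hs, h3⟩
        refine ⟨?_, h3⟩
        intro x hx y hy hxy
        rw [qadj, e]
        have h1 := hs hx
        have h2 := hs hy
        simp [hA] at h1 h2
        exact ⟨fun h => hxy (Fin.ext h), Or.inl ⟨by omega, by omega⟩⟩
    rw [hset, Set.ncard_coe_finset, Finset.card_powersetCard, cA, ha]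
    simp

theorem stmt8 (n m k j : ℕ) (hn : 1 ≤ n) (hm : m ≤ n.choose 2)
    (hj : 1 ≤ j) (hjk : j ≤ k) (hkj : m + j = (k+1).choose 2) :
    (Hval (quasiComplete n k j) : ℚ) =
      (1/2)*(k:ℚ)^4 - (1/2)*(k:ℚ)^3 - 3*(j:ℚ)*(k:ℚ)^2
        + ((j:ℚ)^2 + 7*(j:ℚ) + 1)*(k:ℚ) - (5*(j:ℚ)^2 + 7*(j:ℚ))/2 := by
  obtain ⟨b, rfl⟩ : ∃ b, j = b + 1 := ⟨j - 1, by omega⟩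
  obtain ⟨a, rfl⟩ : ∃ a, k = a + b + 1 := ⟨k - (b+1), by omega⟩
  have hN : a+b+1+1 ≤ n ∨ (a+b+1 ≤ n ∧ a = 0) := by
    have hpas : (a+b+1+1).choose 2 = (a+b+1) + (a+b+1).choose 2 := by
      rw [Nat.choose_succ_succ' (a+b+1) 1]; simp
    have hpas2 : (a+b+1).choose 2 = (a+b) + (a+b).choose 2 := by
      rw [Nat.choose_succ_succ' (a+b) 1]; simp
    by_contra hcon
    by_cases ha : a = 0
    · have hle : n ≤ a + b := by omega
      have := Nat.choose_le_choose 2 hle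
      omega
    · have hle : n ≤ a + b + 1 := by omega
      have := Nat.choose_le_choose 2 hle
      omega
  have h1 := qM2 n a b hN
  have h2 := qk3 n a b hN
  have h3 := two_choose a
  have h4 := six_choose (a+b+1)
  unfold Hval
  rw [h2]
  have h1' := congrArg (fun z : ℤ => (z : ℚ)) h1
  have h3' := congrArg (fun z : ℤ => (z : ℚ)) h3
  have h4' := congrArg (fun z : ℤ => (z : ℚ)) h4
  push_cast at h1' h3' h4' ⊢
  linear_combination (1/2) * h1' - 3 * h3' - h4'
end

section
/- Let n and m be integers with n ≥ 5, 0 ≤ m ≤ C(n,2), and m ∈ {0, 1, 2, 3, C(n,2)−3, C(n,2)−2, C(n,2)−1, C(n,2)}. Then the quasi-star graph S¹_{n,m} is H-optimal in 𝒢_{n,m}, and every H-optimal graph in 𝒢_{n,m} is isomorphic to S¹_{n,m}. -/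
open Finset

open Classical in
noncomputable def aa {V : Type} (G : SimpleGraph V) (u v : V) : ℤ := if G.Adj u v then 1 else 0

noncomputable def dd_s10 {V : Type} [Fintype V] (G : SimpleGraph V) (u : V) : ℤ := ∑ v, aa G u v

noncomputable def SS {V : Type} [Fintype V] (G : SimpleGraph V) : ℤ :=
  ∑ u, ∑ v, aa G u v * (dd_s10 G u * dd_s10 G v)

noncomputable def TT3 {V : Type} [Fintype V] (G : SimpleGraph V) : ℤ :=
  ∑ u, ∑ v, aa G u v * ∑ w, aa G u w * aa G v w

lemma aa_symm {V : Type} (G : SimpleGraph V) (u v : V) : aa G u v = aa G v u := by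
  classical
  unfold aa; exact if_congr (G.adj_comm u v) rfl rfl

lemma aa_self {V : Type} (G : SimpleGraph V) (u : V) : aa G u u = 0 := by
  simp [aa]

lemma aa_sq {V : Type} (G : SimpleGraph V) (u v : V) : aa G u v * aa G u v = aa G u v := by
  simp [aa]

lemma ncard_nbr_s10 {V : Type} [Fintype V] (G : SimpleGraph V) (u : V) :
    ((G.neighborSet u).ncard : ℤ) = dd_s10 G u := by
  classical
  unfold dd_s10 aa
  rw [Set.ncard_eq_toFinset_card']
  rw [Finset.sum_boole]
  congr 2
  ext v; simp

lemma M1_eq {V : Type} [Fintype V] (G : SimpleGraph V) : (M1 G : ℤ) = ∑ u, dd_s10 G u ^ 2 := by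
  unfold M1; push_cast
  simp only [ncard_nbr_s10]

lemma edge_eq_s10 {V : Type} [Fintype V] (G : SimpleGraph V) : 2 * (edgeCount G : ℤ) = ∑ u, dd_s10 G u := by
  classical
  unfold edgeCount
  rw [Set.ncard_eq_toFinset_card']
  have := G.sum_degrees_eq_twice_card_edges
  simp only [← ncard_nbr_s10]
  have h2 : ∀ u, (G.neighborSet u).ncard = G.degree u := by
    intro u
    rw [Set.ncard_eq_toFinset_card', ← SimpleGraph.card_neighborFinset_eq_degree]; rfl
  simp only [h2]
  rw [← Nat.cast_sum, this]; push_cast; rfl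

lemma even_sym {V : Type} [Fintype V] (f : V → V → ℕ) (hs : ∀ u v, f u v = f v u)
    (h0 : ∀ u, f u u = 0) : 2 ∣ ∑ u, ∑ v, f u v := by
  classical
  rw [← Finset.sum_product', ← ZMod.natCast_eq_zero_iff]
  push_cast
  refine Finset.sum_involution (fun p _ => (p.2, p.1)) ?_ ?_ ?_ ?_
  · rintro ⟨a, b⟩ _
    simp only
    rw [hs b a, CharTwo.add_self_eq_zero]
  · rintro ⟨a, b⟩ _ h h'
    simp only [Prod.mk.injEq] at h'
    apply h
    simp [h'.1, h0]
  · simp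
  · simp

lemma M2_eq_s10 {V : Type} [Fintype V] (G : SimpleGraph V) : 2 * (M2 G : ℤ) = SS G := by
  classical
  unfold M2
  have := even_sym (fun u v => if G.Adj u v then (G.neighborSet u).ncard * (G.neighborSet v).ncard else 0)
    (by intro u v; simp [G.adj_comm, mul_comm]) (by simp)
  have h2 := Nat.mul_div_cancel' this
  have h3 : (2 * (M2 G : ℤ)) = ((2 * M2 G : ℕ) : ℤ) := by push_cast; rfl
  unfold M2 at h3
  rw [h3]
  have h4 : ((∑ u : V, ∑ v : V,
    if G.Adj u v then (G.neighborSet u).ncard * (G.neighborSet v).ncard else 0 : ℕ) : ℤ) = SS G := by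
    unfold SS; push_cast
    refine sum_congr rfl fun u _ => sum_congr rfl fun v _ => ?_
    simp only [ncard_nbr_s10, aa]; split_ifs <;> simp
  rw [← h4]
  congr 1

lemma k3_eq_s10 {V : Type} [Fintype V] (G : SimpleGraph V) : 6 * (k3 G : ℤ) = TT3 G := by
  classical
  unfold k3
  rw [Set.ncard_eq_toFinset_card']
  have hT : TT3 G = ((univ.filter (fun p : V × V × V => G.Adj p.1 p.2.1 ∧ G.Adj p.1 p.2.2 ∧ G.Adj p.2.1 p.2.2)).card : ℤ) := by
    rw [← Finset.sum_boole, Fintype.sum_prod_type]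
    unfold TT3
    refine sum_congr rfl fun u _ => ?_
    rw [Fintype.sum_prod_type]
    refine sum_congr rfl fun v _ => ?_
    rw [mul_sum]
    refine sum_congr rfl fun w _ => ?_
    simp only [aa]; split_ifs <;> simp_all
  rw [hT]
  have := Finset.card_eq_sum_card_fiberwise (f := fun p : V × V × V => ({p.1, p.2.1, p.2.2} : Finset V))
    (s := univ.filter (fun p : V × V × V => G.Adj p.1 p.2.1 ∧ G.Adj p.1 p.2.2 ∧ G.Adj p.2.1 p.2.2))
    (t := {s : Finset V | G.IsNClique 3 s}.toFinset) (by
      rintro ⟨a, b, c⟩ h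
      simp at h
      simp [SimpleGraph.is3Clique_triple_iff, h])
  rw [this, Finset.sum_const_nat (m := 6)]
  · push_cast; ring
  · intro s hs
    simp only [Set.mem_toFinset, Set.mem_ofPred_eq, SimpleGraph.is3Clique_iff] at hs
    obtain ⟨a, b, c, hab, hac, hbc, rfl⟩ := hs
    have : (univ.filter (fun p : V × V × V => G.Adj p.1 p.2.1 ∧ G.Adj p.1 p.2.2 ∧ G.Adj p.2.1 p.2.2)).filter
      (fun p : V × V × V => ({p.1, p.2.1, p.2.2} : Finset V) = {a, b, c}) =
      {(a,b,c),(a,c,b),(b,a,c),(b,c,a),(c,a,b),(c,b,a)} := by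
      have nab := hab.ne
      have nac := hac.ne
      have nbc := hbc.ne
      have hba := hab.symm
      have hca := hac.symm
      have hcb := hbc.symm
      ext ⟨x, y, z⟩
      simp only [mem_filter, mem_univ, true_and, mem_insert, mem_singleton, Prod.mk.injEq]
      constructor
      · rintro ⟨⟨h1, h2, h3⟩, h4⟩
        have hx : x ∈ ({a, b, c} : Finset V) := by rw [← h4]; simp
        have hy : y ∈ ({a, b, c} : Finset V) := by rw [← h4]; simp
        have hz : z ∈ ({a, b, c} : Finset V) := by rw [← h4]; simp
        have := h1.ne
        have := h2.ne
        have := h3.ne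
        simp only [mem_insert, mem_singleton] at hx hy hz
        grind
      · rintro (⟨rfl, rfl, rfl⟩ | ⟨rfl, rfl, rfl⟩ | ⟨rfl, rfl, rfl⟩ | ⟨rfl, rfl, rfl⟩ | ⟨rfl, rfl, rfl⟩ | ⟨rfl, rfl, rfl⟩) <;>
        refine ⟨⟨by assumption, by assumption, by assumption⟩, ?_⟩ <;> ext <;> simp <;> tauto
    rw [this]
    have nab := hab.ne
    have nac := hac.ne
    have nbc := hbc.ne
    have nba := hab.ne'
    have nca := hac.ne'
    have ncb := hbc.ne'
    simp [*]

lemma H_eq {V : Type} [Fintype V] (G : SimpleGraph V) : 2 * Hval G = SS G - 2 * TT3 G := by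
  unfold Hval; rw [← M2_eq_s10, ← k3_eq_s10]; ring

lemma dd_compl {V : Type} [Fintype V] (G : SimpleGraph V) (u : V) :
    dd_s10 Gᶜ u = Fintype.card V - 1 - dd_s10 G u := by
  classical
  have : ∀ v, aa Gᶜ u v = 1 - (if u = v then 1 else 0) - aa G u v := by
    intro v; simp only [aa, SimpleGraph.compl_adj]
    by_cases h : u = v
    · subst h; simp
    · by_cases h' : G.Adj u v <;> simp [h, h']
  unfold dd_s10
  simp [this, sum_sub_distrib]

lemma edge_compl {n : ℕ} (G : SimpleGraph (Fin n)) : (edgeCount G : ℤ) + edgeCount Gᶜ = (n.choose 2 : ℕ) := by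
  have h := edge_eq_s10 G
  have h' := edge_eq_s10 Gᶜ
  simp only [dd_compl, sum_sub_distrib] at h'
  have h3 : n.choose 2 * 2 = n * (n-1) := by
    rw [Nat.choose_two_right]; exact Nat.div_two_mul_two_of_even (Nat.even_mul_pred_self n)
  have : ((n.choose 2 : ℕ) : ℤ) * 2 = n * (n - 1) := by
    rcases n with _ | n
    · simp
    · have := congrArg (Nat.cast : ℕ → ℤ) h3
      push_cast at this ⊢
      simpa using this
  simp at h'
  linarith

lemma M1_compl {n : ℕ} (G : SimpleGraph (Fin n)) :
    (M1 Gᶜ : ℤ) = n * (n-1)^2 - 4 * (n-1) * edgeCount G + M1 G := by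
  rw [M1_eq, M1_eq]
  have h := edge_eq_s10 G
  have : ∀ u, dd_s10 Gᶜ u ^ 2 = ((n:ℤ)-1)^2 - 2 * (n-1) * dd_s10 G u + dd_s10 G u ^ 2 := by
    intro u; rw [dd_compl]; simp; ring
  simp only [this, sum_add_distrib, sum_sub_distrib, ← mul_sum, ← h]
  simp; ring

lemma sum_aa_d {V : Type} [Fintype V] (G : SimpleGraph V) :
    ∑ u, ∑ v, aa G u v * dd_s10 G u = ∑ u, dd_s10 G u ^ 2 := by
  refine sum_congr rfl fun u _ => ?_
  rw [← sum_mul]; rw [sq]; rfl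

lemma sum_aa_d' {V : Type} [Fintype V] (G : SimpleGraph V) :
    ∑ u, ∑ v, aa G u v * dd_s10 G v = ∑ u, dd_s10 G u ^ 2 := by
  rw [sum_comm, ← sum_aa_d]
  simp only [aa_symm G]

lemma aa_compl {V : Type} [DecidableEq V] (G : SimpleGraph V) (u v : V) :
    aa Gᶜ u v = 1 - (if u = v then 1 else 0) - aa G u v := by
  simp only [aa, SimpleGraph.compl_adj]
  by_cases h : u = v
  · subst h; simp
  · by_cases h' : G.Adj u v <;> simp [h, h']

lemma SS_compl {V : Type} [Fintype V] (G : SimpleGraph V) : SS Gᶜ + SS G =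
    (∑ u, dd_s10 Gᶜ u)^2 - (∑ u, dd_s10 Gᶜ u ^ 2) - (Fintype.card V - 1)^2 * (∑ u, dd_s10 G u)
     + 2 * (Fintype.card V - 1) * ∑ u, dd_s10 G u ^ 2 := by
  classical
  set N : ℤ := Fintype.card V - 1 with hN
  have e : ∀ u v, aa Gᶜ u v * (dd_s10 Gᶜ u * dd_s10 Gᶜ v) = dd_s10 Gᶜ u * dd_s10 Gᶜ v
     - (if u = v then dd_s10 Gᶜ u * dd_s10 Gᶜ v else 0) - N^2 * aa G u v
     + N * (aa G u v * dd_s10 G u) + N * (aa G u v * dd_s10 G v) - aa G u v * (dd_s10 G u * dd_s10 G v) := by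
    intro u v
    rw [aa_compl]
    have : aa G u v * (dd_s10 Gᶜ u * dd_s10 Gᶜ v) = N^2 * aa G u v
     - N * (aa G u v * dd_s10 G u) - N * (aa G u v * dd_s10 G v) + aa G u v * (dd_s10 G u * dd_s10 G v) := by
      rw [dd_compl, dd_compl]; ring
    split_ifs <;> linarith
  have h1 : SS Gᶜ = ∑ u, ∑ v, (dd_s10 Gᶜ u * dd_s10 Gᶜ v
     - (if u = v then dd_s10 Gᶜ u * dd_s10 Gᶜ v else 0) - N^2 * aa G u v
     + N * (aa G u v * dd_s10 G u) + N * (aa G u v * dd_s10 G v) - aa G u v * (dd_s10 G u * dd_s10 G v)) := by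
    unfold SS; simp only [e]
  rw [h1]
  simp only [sum_add_distrib, sum_sub_distrib, ← mul_sum, sum_aa_d, sum_aa_d']
  simp only [Finset.sum_ite_eq, mem_univ, if_true]
  have h2 : ∑ u, ∑ v, aa G u v = ∑ u, dd_s10 G u := rfl
  have h3 : ∑ u, ∑ v, aa G u v * (dd_s10 G u * dd_s10 G v) = SS G := rfl
  rw [h2, h3, ← sum_mul]
  simp only [← sq]
  ring

lemma TT_compl {V : Type} [Fintype V] (G : SimpleGraph V) : TT3 Gᶜ + TT3 G =
    Fintype.card V * (Fintype.card V - 1) * (Fintype.card V - 2)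
     - 3 * (Fintype.card V - 1) * (∑ u, dd_s10 G u) + 3 * ∑ u, dd_s10 G u ^ 2 := by
  classical
  set n : ℤ := (Fintype.card V : ℤ) with hn
  set c : V → V → ℤ := fun u v => ∑ w, aa G u w * aa G v w with hc
  have e1 : ∀ u v, ∑ w, aa Gᶜ u w * aa Gᶜ v w =
      n - 2 - dd_s10 G u - dd_s10 G v + (if u = v then 1 else 0) + 2 * aa G u v + c u v := by
    intro u v
    have : ∀ w, aa Gᶜ u w * aa Gᶜ v w = 1 - (if v = w then 1 else 0) - (if u = w then 1 else 0)
       - aa G u w - aa G v w + (if u = w then (if v = w then 1 else 0) else 0)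
       + (if u = w then aa G v w else 0) + (if v = w then aa G u w else 0) + aa G u w * aa G v w := by
      intro w; rw [aa_compl, aa_compl]; split_ifs <;> ring
    simp only [this, sum_add_distrib, sum_sub_distrib, Finset.sum_ite_eq, mem_univ, if_true]
    have h4 : ∑ v, aa G u v = dd_s10 G u := rfl
    have h5 : ∑ w, aa G v w = dd_s10 G v := rfl
    rw [h4, h5, aa_symm G v u]
    have h6 : (if v = u then (1:ℤ) else 0) = if u = v then 1 else 0 := by simp [eq_comm]
    rw [h6]
    simp [hc, ← hn]; ring
  have cu : ∀ u, c u u = dd_s10 G u := by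
    intro u; simp only [hc, aa_sq]; rfl
  have e2 : ∀ u v, aa Gᶜ u v * ∑ w, aa Gᶜ u w * aa Gᶜ v w =
      n - 2 - dd_s10 G u - dd_s10 G v + c u v - (n - 2) * aa G u v + aa G u v * dd_s10 G u + aa G u v * dd_s10 G v
      - aa G u v * c u v - (if u = v then n - 2 - dd_s10 G u  else 0) := by
    intro u v
    rw [e1, aa_compl]
    have := aa_sq G u v
    by_cases h : u = v
    · subst h
      simp [aa_self, cu]
    · simp [h]; linear_combination (-2) * this
  have h1 : TT3 Gᶜ = ∑ u, ∑ v, (n - 2 - dd_s10 G u - dd_s10 G v + c u v - (n - 2) * aa G u v + aa G u v * dd_s10 G u + aa G u v * dd_s10 G v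
      - aa G u v * c u v - (if u = v then n - 2 - dd_s10 G u  else 0)) := by
    unfold TT3; simp only [e2]
  have h2 : ∑ u, ∑ v, aa G u v = ∑ u, dd_s10 G u := rfl
  have h3 : ∑ u, ∑ v, aa G u v * c u v = TT3 G := rfl
  have h4 : ∑ u, ∑ v, c u v = ∑ u, dd_s10 G u ^ 2 := by
    rw [← sum_aa_d' G]
    refine sum_congr rfl fun u _ => ?_
    simp only [hc]
    rw [sum_comm]
    refine sum_congr rfl fun w _ => ?_
    rw [← mul_sum]; congr 1
    unfold dd_s10; simp only [aa_symm G]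
  rw [h1]
  simp only [sum_add_distrib, sum_sub_distrib, ← mul_sum, sum_aa_d, sum_aa_d', h2, h3, h4]
  simp [← mul_sum, ← hn]
  ring

/-- `H(G) + H(Gᶜ)` depends only on the number of edges and `M₁`. -/
lemma H_compl {n : ℕ} (G G' : SimpleGraph (Fin n)) (he : edgeCount G = edgeCount G')
    (hM : M1 G = M1 G') : Hval G + Hval Gᶜ = Hval G' + Hval G'ᶜ := by
  have h1 := H_eq G
  have h2 := H_eq Gᶜ
  have h3 := H_eq G'
  have h4 := H_eq G'ᶜ
  have a1 := SS_compl G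
  have a2 := SS_compl G'
  have b1 := TT_compl G
  have b2 := TT_compl G'
  have c1 := M1_compl G
  have c2 := M1_compl G'
  rw [he, hM, ← c2] at c1
  have d1 := edge_compl G
  have d2 := edge_compl G'
  have d3 : edgeCount Gᶜ = edgeCount G'ᶜ := by omega
  rw [← M1_eq, ← M1_eq, ← edge_eq_s10, ← edge_eq_s10] at a1 a2
  rw [← M1_eq, ← edge_eq_s10] at b1 b2
  rw [c1, hM, he, d3, ← a2] at a1
  rw [hM, he, ← b2] at b1
  linarith

lemma sum_emb {W V : Type} [Fintype W] [Fintype V] (f : W ↪ V) (F : V → ℤ)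
    (h : ∀ v, v ∉ Set.range f → F v = 0) : ∑ v, F v = ∑ i, F (f i) := by
  classical
  rw [← Finset.sum_map univ f F]
  symm
  apply Finset.sum_subset (subset_univ _)
  intro v _ hv
  apply h
  simpa using hv

lemma aa_map {W V : Type} (K : SimpleGraph W) (f : W ↪ V) (i j : W) :
    aa (K.map f) (f i) (f j) = aa K i j := by
  classical
  unfold aa; congr 1; exact propext SimpleGraph.map_adj_apply

lemma aa_map_l {W V : Type} (K : SimpleGraph W) (f : W ↪ V) (u v : V) (h : u ∉ Set.range f) :
    aa (K.map f) u v = 0 := by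
  unfold aa
  rw [if_neg]
  rw [SimpleGraph.map_adj]
  rintro ⟨a, b, _, rfl, _⟩
  exact h ⟨a, rfl⟩

lemma aa_map_r {W V : Type} (K : SimpleGraph W) (f : W ↪ V) (u v : V) (h : v ∉ Set.range f) :
    aa (K.map f) u v = 0 := by
  rw [aa_symm, aa_map_l _ _ _ _ h]

lemma dd_map {W V : Type} [Fintype W] [Fintype V] (K : SimpleGraph W) (f : W ↪ V) (i : W) :
    dd_s10 (K.map f) (f i) = dd_s10 K i := by
  unfold dd_s10
  rw [sum_emb f _ (fun v hv => aa_map_r K f _ v hv)]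
  simp only [aa_map]

lemma dd_map0 {W V : Type} [Fintype W] [Fintype V] (K : SimpleGraph W) (f : W ↪ V) (v : V)
    (hv : v ∉ Set.range f) : dd_s10 (K.map f) v = 0 := by
  unfold dd_s10
  simp [aa_map_l K f v _ hv]

lemma SS_map {W V : Type} [Fintype W] [Fintype V] (K : SimpleGraph W) (f : W ↪ V) :
    SS (K.map f) = SS K := by
  unfold SS
  rw [sum_emb f _ (fun v hv => by simp [aa_map_l K f v _ hv])]
  refine sum_congr rfl fun i _ => ?_
  rw [sum_emb f _ (fun v hv => by simp [aa_map_r K f _ v hv])]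
  simp only [aa_map, dd_map]

lemma TT3_map {W V : Type} [Fintype W] [Fintype V] (K : SimpleGraph W) (f : W ↪ V) :
    TT3 (K.map f) = TT3 K := by
  unfold TT3
  rw [sum_emb f _ (fun v hv => by simp [aa_map_l K f v _ hv])]
  refine sum_congr rfl fun i _ => ?_
  rw [sum_emb f _ (fun v hv => by simp [aa_map_r K f _ v hv])]
  refine sum_congr rfl fun j _ => ?_
  rw [sum_emb f _ (fun v hv => by simp [aa_map_r K f _ v hv])]
  simp only [aa_map]

lemma H_map {W V : Type} [Fintype W] [Fintype V] (K : SimpleGraph W) (f : W ↪ V) :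
    Hval (K.map f) = Hval K := by
  have h1 := H_eq (K.map f)
  have h2 := H_eq K
  rw [SS_map, TT3_map] at h1
  linarith

lemma edge_map {W V : Type} [Fintype W] [Fintype V] (K : SimpleGraph W) (f : W ↪ V) :
    edgeCount (K.map f) = edgeCount K := by
  have h1 := edge_eq_s10 (K.map f)
  have h2 := edge_eq_s10 K
  rw [sum_emb f _ (fun v hv => dd_map0 K f v hv)] at h1
  simp only [dd_map] at h1
  omega

lemma M1_map {W V : Type} [Fintype W] [Fintype V] (K : SimpleGraph W) (f : W ↪ V) :
    M1 (K.map f) = M1 K := by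
  have h1 := M1_eq (K.map f)
  have h2 := M1_eq K
  rw [sum_emb f _ (fun v hv => by rw [dd_map0 K f v hv]; rfl)] at h1
  simp only [dd_map] at h1
  omega

lemma iso_map {k n : ℕ} (K : SimpleGraph (Fin k)) (f g : Fin k ↪ Fin n) :
    Nonempty (K.map f ≃g K.map g) := by
  obtain ⟨σ, hσ⟩ := Equiv.Perm.exists_smul_eq_embedding f g
  have : ⇑g = σ ∘ f := by
    rw [← hσ]; rfl
  rw [this, ← SimpleGraph.map_map]
  exact ⟨SimpleGraph.Iso.map σ _⟩

def starG (t : ℕ) : SimpleGraph (Fin (t+1)) where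
  Adj i j := i ≠ j ∧ (i = 0 ∨ j = 0)
  symm := ⟨fun _ _ h => ⟨h.1.symm, h.2.symm⟩⟩
  loopless := ⟨fun _ h => h.1 rfl⟩

lemma aa_star (t : ℕ) (i j : Fin (t+1)) :
    aa (starG t) i j = if i ≠ j ∧ (i = 0 ∨ j = 0) then 1 else 0 := by
  unfold aa; congr 1

lemma aa_top (i j : Fin 3) :
    aa (⊤ : SimpleGraph (Fin 3)) i j = if i ≠ j then 1 else 0 := by
  unfold aa; congr 1

lemma star_edge (t : ℕ) (ht : t ≤ 3) : edgeCount (starG t) = t := by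
  have h := edge_eq_s10 (starG t)
  have : ∑ u, dd_s10 (starG t) u = 2 * t := by
    simp only [dd_s10, aa_star]
    interval_cases t <;> decide
  omega

lemma star_M1 (t : ℕ) (ht : t ≤ 3) : M1 (starG t) = t * (t + 1) := by
  have h := M1_eq (starG t)
  have : ∑ u, dd_s10 (starG t) u ^ 2 = t * (t + 1) := by
    simp only [dd_s10, aa_star]
    interval_cases t <;> decide
  rw [this] at h
  exact_mod_cast h

lemma tri_edge : edgeCount (⊤ : SimpleGraph (Fin 3)) = 3 := by
  have h := edge_eq_s10 (⊤ : SimpleGraph (Fin 3))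
  have : ∑ u, dd_s10 (⊤ : SimpleGraph (Fin 3)) u = 6 := by
    simp only [dd_s10, aa_top]; decide
  omega

lemma tri_M1 : M1 (⊤ : SimpleGraph (Fin 3)) = 12 := by
  have h := M1_eq (⊤ : SimpleGraph (Fin 3))
  have : ∑ u, dd_s10 (⊤ : SimpleGraph (Fin 3)) u ^ 2 = 12 := by
    simp only [dd_s10, aa_top]; decide
  omega

set_option maxRecDepth 10000 in
lemma star_H : Hval (starG 3) = 9 := by
  have h := H_eq (starG 3)
  have h1 : SS (starG 3) = 18 := by
    simp only [SS, dd_s10, aa_star]; decide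
  have h2 : TT3 (starG 3) = 0 := by
    simp only [TT3, aa_star]; decide
  omega

set_option maxRecDepth 10000 in
lemma tri_H : Hval (⊤ : SimpleGraph (Fin 3)) = 6 := by
  have h := H_eq (⊤ : SimpleGraph (Fin 3))
  have h1 : SS (⊤ : SimpleGraph (Fin 3)) = 24 := by
    simp only [SS, dd_s10, aa_top]; decide
  have h2 : TT3 (⊤ : SimpleGraph (Fin 3)) = 6 := by
    simp only [TT3, aa_top]; decide
  omega

lemma dd_deg {V : Type} [Fintype V] (G : SimpleGraph V) [DecidableRel G.Adj] (u : V) :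
    dd_s10 G u = G.degree u := by
  rw [← ncard_nbr_s10, Set.ncard_eq_toFinset_card', ← SimpleGraph.card_neighborFinset_eq_degree]
  rfl

lemma dd_add_le {V : Type} [Fintype V] (G : SimpleGraph V) (u v : V) (h : G.Adj u v) :
    dd_s10 G u + dd_s10 G v ≤ edgeCount G + 1 ∧ (dd_s10 G u + dd_s10 G v = edgeCount G + 1 →
      ∀ x y, G.Adj x y → x = u ∨ x = v ∨ y = u ∨ y = v) := by
  classical
  rw [dd_deg, dd_deg, ← G.card_incidenceFinset_eq_degree, ← G.card_incidenceFinset_eq_degree]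
  have h1 := Finset.card_union_add_card_inter (G.incidenceFinset u) (G.incidenceFinset v)
  have h2 : (G.incidenceFinset u ∩ G.incidenceFinset v).card ≤ 1 := by
    rw [Finset.card_le_one]
    intro a ha b hb
    simp only [mem_inter, SimpleGraph.mem_incidenceFinset, SimpleGraph.incidenceSet] at ha hb
    have e : ∀ a : Sym2 V, u ∈ a → v ∈ a → a = s(u, v) := by
      intro a h1 h2
      exact (Sym2.mem_and_mem_iff h.ne).1 ⟨h1, h2⟩
    rw [e a ha.1.2 ha.2.2, e b hb.1.2 hb.2.2]
  have h3 : G.incidenceFinset u ∪ G.incidenceFinset v ⊆ G.edgeFinset :=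
    union_subset (G.incidenceFinset_subset u) (G.incidenceFinset_subset v)
  have h4 : edgeCount G = G.edgeFinset.card := by
    unfold edgeCount
    rw [Set.ncard_eq_toFinset_card']
    rfl
  have h5 := card_le_card h3
  refine ⟨by omega, fun he x y hxy => ?_⟩
  have h6 : G.incidenceFinset u ∪ G.incidenceFinset v = G.edgeFinset :=
    eq_of_subset_of_card_le h3 (by omega)
  have h7 : s(x, y) ∈ G.edgeFinset := by simpa using hxy
  rw [← h6] at h7
  simp [SimpleGraph.incidenceSet] at h7
  grind

lemma M1_bound {V : Type} [Fintype V] (G : SimpleGraph V) :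
    M1 G ≤ edgeCount G * (edgeCount G + 1) ∧ (M1 G = edgeCount G * (edgeCount G + 1) →
      ∀ u v, G.Adj u v → ∀ x y, G.Adj x y → x = u ∨ x = v ∨ y = u ∨ y = v) := by
  classical
  have h1 := sum_aa_d G
  have h2 := sum_aa_d' G
  rw [← M1_eq] at h1 h2
  set t := edgeCount G with ht
  have h3 : ∑ u, ∑ v, aa G u v = 2 * (t : ℤ) := (edge_eq_s10 G).symm
  have h4 : ∑ u, ∑ v, aa G u v * (t + 1 - dd_s10 G u - dd_s10 G v) = 2 * ((t : ℤ) * (t + 1) - M1 G) := by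
    have : ∀ u v, aa G u v * (t + 1 - dd_s10 G u - dd_s10 G v) =
      (t + 1) * aa G u v - aa G u v * dd_s10 G u - aa G u v * dd_s10 G v := by intros; ring
    simp only [this, sum_sub_distrib, ← mul_sum, h1, h2, h3]
    ring
  have h5 : ∀ u v, 0 ≤ aa G u v * (t + 1 - dd_s10 G u - dd_s10 G v) := by
    intro u v
    unfold aa
    split_ifs with h
    · have := (dd_add_le G u v h).1
      rw [one_mul]; linarith
    · simp
  have h6 : 0 ≤ 2 * ((t : ℤ) * (t + 1) - M1 G) := by
    rw [← h4]
    exact sum_nonneg fun u _ => sum_nonneg fun v _ => h5 u v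
  refine ⟨by zify; linarith, fun he u v huv => ?_⟩
  apply (dd_add_le G u v huv).2
  have h7 : ∑ u, ∑ v, aa G u v * (t + 1 - dd_s10 G u - dd_s10 G v) = 0 := by
    rw [h4, he]; push_cast; ring
  rw [sum_eq_zero_iff_of_nonneg (fun u _ => sum_nonneg fun v _ => h5 u v)] at h7
  have h8 := h7 u (mem_univ _)
  rw [sum_eq_zero_iff_of_nonneg (fun v _ => h5 u v)] at h8
  have h9 := h8 v (mem_univ _)
  simp [aa, huv] at h9
  linarith

lemma star1_of {n : ℕ} (G : SimpleGraph (Fin n)) (p q : Fin n) (h1 : p ≠ q)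
    (hA : ∀ x y, G.Adj x y ↔ (x = p ∧ y = q ∨ x = q ∧ y = p)) :
    ∃ f : Fin 2 ↪ Fin n, G = (starG 1).map f := by
  have hi : Function.Injective ![p, q] := by
    intro i j; fin_cases i <;> fin_cases j <;> simp [h1, h1.symm]
  refine ⟨⟨_, hi⟩, ?_⟩
  ext u v
  rw [hA, SimpleGraph.map_adj]
  simp [starG, Fin.exists_fin_succ]
  grind

lemma star2_of {n : ℕ} (G : SimpleGraph (Fin n)) (p q r : Fin n) (h1 : p ≠ q) (h2 : p ≠ r) (h3 : q ≠ r)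
    (hA : ∀ x y, G.Adj x y ↔ (x = p ∧ y = q ∨ x = q ∧ y = p) ∨ (x = p ∧ y = r ∨ x = r ∧ y = p)) :
    ∃ f : Fin 3 ↪ Fin n, G = (starG 2).map f := by
  have hi : Function.Injective ![p, q, r] := by
    intro i j; fin_cases i <;> fin_cases j <;> simp [h1, h1.symm, h2, h2.symm, h3, h3.symm]
  refine ⟨⟨_, hi⟩, ?_⟩
  ext u v
  rw [hA, SimpleGraph.map_adj]
  simp [starG, Fin.exists_fin_succ]
  grind

lemma star3_of {n : ℕ} (G : SimpleGraph (Fin n)) (p q r s : Fin n) (h1 : p ≠ q) (h2 : p ≠ r) (h3 : q ≠ r)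
    (h4 : p ≠ s) (h5 : q ≠ s) (h6 : r ≠ s)
    (hA : ∀ x y, G.Adj x y ↔ (x = p ∧ y = q ∨ x = q ∧ y = p) ∨ (x = p ∧ y = r ∨ x = r ∧ y = p)
      ∨ (x = p ∧ y = s ∨ x = s ∧ y = p)) :
    ∃ f : Fin 4 ↪ Fin n, G = (starG 3).map f := by
  have hi : Function.Injective ![p, q, r, s] := by
    intro i j; fin_cases i <;> fin_cases j <;> simp [h1, h1.symm, h2, h2.symm, h3, h3.symm, h4, h4.symm, h5, h5.symm, h6, h6.symm]
  refine ⟨⟨_, hi⟩, ?_⟩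
  ext u v
  rw [hA, SimpleGraph.map_adj]
  simp [starG, Fin.exists_fin_succ]
  grind

lemma tri_of {n : ℕ} (G : SimpleGraph (Fin n)) (p q r : Fin n) (h1 : p ≠ q) (h2 : p ≠ r) (h3 : q ≠ r)
    (hA : ∀ x y, G.Adj x y ↔ (x = p ∧ y = q ∨ x = q ∧ y = p) ∨ (x = p ∧ y = r ∨ x = r ∧ y = p)
       ∨ (x = q ∧ y = r ∨ x = r ∧ y = q)) :
    ∃ f : Fin 3 ↪ Fin n, G = (⊤ : SimpleGraph (Fin 3)).map f := by
  have hi : Function.Injective ![p, q, r] := by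
    intro i j; fin_cases i <;> fin_cases j <;> simp [h1, h1.symm, h2, h2.symm, h3, h3.symm]
  refine ⟨⟨_, hi⟩, ?_⟩
  ext u v
  rw [hA, SimpleGraph.map_adj]
  simp [Fin.exists_fin_succ]
  grind

lemma star0_of {n : ℕ} (hn : 5 ≤ n) (G : SimpleGraph (Fin n))
    (hA : ∀ x y, ¬ G.Adj x y) :
    ∃ f : Fin 1 ↪ Fin n, G = (starG 0).map f := by
  refine ⟨⟨fun _ => ⟨0, by omega⟩, fun a b _ => Subsingleton.elim a b⟩, ?_⟩
  ext u v
  rw [SimpleGraph.map_adj]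
  simp [starG, Fin.exists_fin_succ, hA]

lemma two_edges {V : Type} (a b c d : V) (h1 : a ≠ b) (h2 : c ≠ d) (hne : s(a,b) ≠ s(c,d))
    (h : c = a ∨ c = b ∨ d = a ∨ d = b) :
    ∃ p q r, p ≠ q ∧ p ≠ r ∧ q ≠ r ∧ s(a,b) = s(p,q) ∧ s(c,d) = s(p,r) := by
  simp only [ne_eq, Sym2.eq_iff] at hne ⊢
  rcases h with rfl | rfl | rfl | rfl
  · exact ⟨c, b, d, h1, h2, by tauto, by tauto, by tauto⟩
  · exact ⟨c, a, d, h1.symm, h2, by tauto, by tauto, by tauto⟩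
  · exact ⟨d, b, c, h1, h2.symm, by tauto, by tauto, by tauto⟩
  · exact ⟨d, a, c, h1.symm, h2.symm, by tauto, by tauto, by tauto⟩

lemma third_edge {V : Type} (p q r x y : V) (h1 : p ≠ q) (h2 : p ≠ r) (h3 : q ≠ r) (h4 : x ≠ y)
    (n1 : s(p,q) ≠ s(x,y)) (n2 : s(p,r) ≠ s(x,y))
    (i1 : x = p ∨ x = q ∨ y = p ∨ y = q) (i2 : x = p ∨ x = r ∨ y = p ∨ y = r) :
    (∃ s, p ≠ s ∧ q ≠ s ∧ r ≠ s ∧ s(x,y) = s(p,s)) ∨ s(x,y) = s(q,r) := by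
  simp only [ne_eq, Sym2.eq_iff] at n1 n2 ⊢
  by_cases hx : x = p
  · subst hx
    left; exact ⟨y, h4, by grind, by grind, by grind⟩
  · by_cases hy : y = p
    · subst hy
      left; exact ⟨x, by grind, by grind, by grind, by grind⟩
    · right; grind

lemma classify {n : ℕ} (hn : 5 ≤ n) (G : SimpleGraph (Fin n)) (t : ℕ) (ht : t ≤ 3) (he : edgeCount G = t)
    (h : ∀ u v, G.Adj u v → ∀ x y, G.Adj x y → x = u ∨ x = v ∨ y = u ∨ y = v) :
    (∃ f : Fin (t+1) ↪ Fin n, G = (starG t).map f) ∨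
      (t = 3 ∧ ∃ f : Fin 3 ↪ Fin n, G = (⊤ : SimpleGraph (Fin 3)).map f) := by
  classical
  have h4 : G.edgeFinset.card = t := by
    rw [← he]
    unfold edgeCount
    rw [Set.ncard_eq_toFinset_card']
    rfl
  have hA : ∀ x y, G.Adj x y ↔ s(x, y) ∈ G.edgeFinset := by simp
  interval_cases t
  · left
    rw [card_eq_zero] at h4
    apply star0_of hn
    intro x y
    rw [hA, h4]; simp
  · left
    rw [card_eq_one] at h4
    obtain ⟨e, he⟩ := h4
    induction e with | _ a b
    have hab : G.Adj a b := by rw [hA, he]; simp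
    apply star1_of G a b hab.ne
    intro x y
    rw [hA, he, mem_singleton, Sym2.eq_iff]
  · left
    rw [card_eq_two] at h4
    obtain ⟨e, e', hne, he⟩ := h4
    induction e with | _ a b
    induction e' with | _ c d
    have hab : G.Adj a b := by rw [hA, he]; simp
    have hcd : G.Adj c d := by rw [hA, he]; simp
    obtain ⟨p, q, r, h1, h2, h3, h4, h5⟩ := two_edges a b c d hab.ne hcd.ne hne (h a b hab c d hcd)
    apply star2_of G p q r h1 h2 h3
    intro x y
    rw [hA, he, h4, h5, mem_insert, mem_singleton, Sym2.eq_iff, Sym2.eq_iff]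
  · rw [card_eq_three] at h4
    obtain ⟨e, e', e'', hne, hne', hne'', he⟩ := h4
    induction e with | _ a b
    induction e' with | _ c d
    induction e'' with | _ x y
    have hab : G.Adj a b := by rw [hA, he]; simp
    have hcd : G.Adj c d := by rw [hA, he]; simp
    have hxy : G.Adj x y := by rw [hA, he]; simp
    obtain ⟨p, q, r, h1, h2, h3, h4, h5⟩ := two_edges a b c d hab.ne hcd.ne hne (h a b hab c d hcd)
    rw [h4] at hne' he
    rw [h5] at hne'' he
    have hpq : G.Adj p q := by rw [hA, he]; simp
    have hpr : G.Adj p r := by rw [hA, he]; simp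
    rcases third_edge p q r x y h1 h2 h3 hxy.ne hne' hne'' (h p q hpq x y hxy) (h p r hpr x y hxy) with
      ⟨s, g1, g2, g3, g4⟩ | g4
    · left
      apply star3_of G p q r s h1 h2 h3 g1 g2 g3
      intro x y
      rw [hA, he, g4]
      simp only [mem_insert, mem_singleton, Sym2.eq_iff]
    · right
      refine ⟨rfl, ?_⟩
      apply tri_of G p q r h1 h2 h3
      intro x y
      rw [hA, he, g4]
      simp only [mem_insert, mem_singleton, Sym2.eq_iff]

lemma starEmb {n : ℕ} (hn : 5 ≤ n) (t : ℕ) (ht : t ≤ 3) : Nonempty (Fin (t+1) ↪ Fin n) :=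
  ⟨Fin.castLEEmb (by omega)⟩

lemma mopt_iff {n : ℕ} (hn : 5 ≤ n) (t : ℕ) (ht : t ≤ 3) (G : SimpleGraph (Fin n)) :
    MOptimal t G ↔ edgeCount G = t ∧ M1 G = t * (t + 1) := by
  constructor
  · rintro ⟨h1, h2⟩
    refine ⟨h1, ?_⟩
    obtain ⟨f⟩ := starEmb hn t ht
    have h3 := h2 ((starG t).map f) (by rw [edge_map, star_edge t ht])
    rw [M1_map, star_M1 t ht] at h3
    have h4 := (M1_bound G).1
    rw [h1] at h4
    omega
  · rintro ⟨h1, h2⟩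
    refine ⟨h1, fun G' h' => ?_⟩
    have h4 := (M1_bound G').1
    rw [h'] at h4
    omega

lemma mopt_class {n : ℕ} (hn : 5 ≤ n) (t : ℕ) (ht : t ≤ 3) (G : SimpleGraph (Fin n)) (h : MOptimal t G) :
    (∃ f : Fin (t+1) ↪ Fin n, G = (starG t).map f) ∨
      (t = 3 ∧ ∃ f : Fin 3 ↪ Fin n, G = (⊤ : SimpleGraph (Fin 3)).map f) := by
  rw [mopt_iff hn t ht] at h
  apply classify hn G t ht h.1
  apply (M1_bound G).2
  rw [h.1, h.2]

lemma mopt_star {n : ℕ} (hn : 5 ≤ n) (t : ℕ) (ht : t ≤ 3) (f : Fin (t+1) ↪ Fin n) :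
    MOptimal t ((starG t).map f) := by
  rw [mopt_iff hn t ht, edge_map, M1_map, star_edge t ht, star_M1 t ht]; simp

lemma mopt_tri {n : ℕ} (hn : 5 ≤ n) (f : Fin 3 ↪ Fin n) :
    MOptimal 3 ((⊤ : SimpleGraph (Fin 3)).map f) := by
  rw [mopt_iff hn 3 (by norm_num), edge_map, M1_map, tri_edge, tri_M1]; simp

lemma mopt_compl {n : ℕ} (t m : ℕ) (hm : m + t = n.choose 2) (G : SimpleGraph (Fin n)) :
    MOptimal m Gᶜ ↔ MOptimal t G := by
  have e : ∀ G : SimpleGraph (Fin n), edgeCount Gᶜ = m ↔ edgeCount G = t := by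
    intro G; have := edge_compl G; omega
  unfold MOptimal
  rw [e]
  refine and_congr_right fun h => ⟨fun h1 G' h' => ?_, fun h1 G' h' => ?_⟩
  · have a := h1 G'ᶜ ((e G').2 h')
    have b := M1_compl G
    have c := M1_compl G'
    rw [h] at b
    rw [h'] at c
    zify at a ⊢
    linarith
  · have h'' : edgeCount G'ᶜ = t := by rw [← e, compl_compl]; exact h'
    have a := h1 G'ᶜ h''
    have b := M1_compl G
    have c := M1_compl G'ᶜ
    rw [h] at b
    rw [h'', compl_compl] at c
    zify at a ⊢
    linarith

lemma small_case {n : ℕ} (hn : 5 ≤ n) (t : ℕ) (ht : t ≤ 3) (Q : SimpleGraph (Fin n))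
    (hQ : ∃ f : Fin (t+1) ↪ Fin n, Q = (starG t).map f) :
    HOptimal t Q ∧ ∀ G' : SimpleGraph (Fin n), HOptimal t G' → Nonempty (G' ≃g Q) := by
  obtain ⟨f, rfl⟩ := hQ
  refine ⟨⟨mopt_star hn t ht f, fun G' h' => ?_⟩, fun G' h' => ?_⟩
  · rcases mopt_class hn t ht G' h' with ⟨g, rfl⟩ | ⟨rfl, g, rfl⟩
    · rw [H_map, H_map]
    · rw [H_map, H_map, tri_H, star_H]; norm_num
  · rcases mopt_class hn t ht G' h'.1 with ⟨g, rfl⟩ | ⟨rfl, g, rfl⟩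
    · exact iso_map _ _ _
    · have := h'.2 _ (mopt_star hn 3 ht f)
      rw [H_map, H_map, tri_H, star_H] at this
      norm_num at this

lemma mopt_H_compl {n : ℕ} (hn : 5 ≤ n) (t : ℕ) (ht : t ≤ 3) (G G' : SimpleGraph (Fin n))
    (h : MOptimal t G) (h' : MOptimal t G') : Hval G + Hval Gᶜ = Hval G' + Hval G'ᶜ := by
  rw [mopt_iff hn t ht] at h h'
  exact H_compl G G' (by omega) (by omega)

lemma iso_compl {n : ℕ} {G G' : SimpleGraph (Fin n)} (h : Nonempty (G ≃g G')) : Nonempty (Gᶜ ≃g G'ᶜ) := by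
  obtain ⟨e⟩ := h
  refine ⟨⟨e.toEquiv, ?_⟩⟩
  intro a b
  simp [SimpleGraph.compl_adj, SimpleGraph.Iso.map_adj_iff]

lemma large_case {n : ℕ} (hn : 5 ≤ n) (t m : ℕ) (ht : t ≤ 3) (hm : m + t = n.choose 2)
    (Q : SimpleGraph (Fin n))
    (hQ : (t < 3 ∧ ∃ f : Fin (t+1) ↪ Fin n, Q = (starG t).map f) ∨
      (t = 3 ∧ ∃ f : Fin 3 ↪ Fin n, Q = (⊤ : SimpleGraph (Fin 3)).map f)) :
    HOptimal m Qᶜ ∧ ∀ G' : SimpleGraph (Fin n), HOptimal m G' → Nonempty (G' ≃g Qᶜ) := by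
  have hQM : MOptimal t Q := by
    rcases hQ with ⟨_, f, rfl⟩ | ⟨rfl, f, rfl⟩
    · exact mopt_star hn t ht f
    · exact mopt_tri hn f
  have hle : ∀ G : SimpleGraph (Fin n), MOptimal t G → Hval Q ≤ Hval G ∧ (Hval G ≤ Hval Q → Nonempty (G ≃g Q)) := by
    intro G hG
    rcases hQ with ⟨_, f, rfl⟩ | ⟨rfl, f, rfl⟩
    · rcases mopt_class hn t ht G hG with ⟨g, rfl⟩ | ⟨rfl, g, rfl⟩
      · exact ⟨by rw [H_map, H_map], fun _ => iso_map _ _ _⟩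
      · omega
    · rcases mopt_class hn 3 ht G hG with ⟨g, rfl⟩ | ⟨_, g, rfl⟩
      · rw [H_map, H_map, tri_H, star_H]
        exact ⟨by norm_num, fun h => by norm_num at h⟩
      · exact ⟨by rw [H_map, H_map], fun _ => iso_map _ _ _⟩
  have hQ' : MOptimal m Qᶜ := (mopt_compl t m hm Q).2 hQM
  refine ⟨⟨hQ', fun G' h' => ?_⟩, fun G' h' => ?_⟩
  · rw [← compl_compl G', mopt_compl t m hm] at h'
    have a := mopt_H_compl hn t ht _ _ hQM h'
    have b := (hle _ h').1
    rw [compl_compl] at a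
    linarith
  · have h1 := h'.1
    have h2 := h'.2 _ hQ'
    rw [← compl_compl G', mopt_compl t m hm] at h1
    have a := mopt_H_compl hn t ht _ _ hQM h1
    rw [compl_compl] at a
    have := iso_compl ((hle _ h1).2 (by linarith))
    rwa [compl_compl] at this

lemma choose_step (a b : ℕ) (h : a ≤ b) : a.choose 2 ≤ b.choose 2 := Nat.choose_le_choose 2 h

lemma choose_succ2 (a : ℕ) : (a+1).choose 2 = a + a.choose 2 := by
  rw [Nat.choose_succ_succ' a 1]; simp

lemma small_params (n t k j : ℕ) (hn : 5 ≤ n) (ht : t ≤ 3) (hj : 1 ≤ j) (hjk : j ≤ k)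
    (h : t + (k+1).choose 2 = n.choose 2 + j) : (t = 0 ∧ k = n ∧ j = n) ∨ (1 ≤ t ∧ k + 1 = n ∧ j = t) := by
  have s := choose_succ2 k
  have h1 : k ≤ n := by
    by_contra hc
    have a := choose_step (n+1) k (by omega)
    have b := choose_succ2 n
    omega
  have h2 : n ≤ k + 1 := by
    by_contra hc
    obtain ⟨n, rfl⟩ : ∃ n', n = n' + 1 := ⟨n - 1, by omega⟩
    have a := choose_step (k+1) n (by omega)
    have b := choose_succ2 n
    omega
  rcases (by omega : k = n ∨ k + 1 = n) with rfl | rfl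
  · left; omega
  · right; omega

lemma large_params (n m t k j : ℕ) (ht : t ≤ 3) (hm : m + t = n.choose 2) (hj : 1 ≤ j) (hjk : j ≤ k)
    (h : m + (k+1).choose 2 = n.choose 2 + j) :
    (t = 0 ∧ k = 1 ∧ j = 1) ∨ (t = 1 ∧ k = 2 ∧ j = 2) ∨ (t = 2 ∧ k = 2 ∧ j = 1) ∨ (t = 3 ∧ k = 3 ∧ j = 3) := by
  have s := choose_succ2 k
  have hk : k ≤ 3 := by
    by_contra hc
    have a := choose_step 4 k (by omega)
    have b : Nat.choose 4 2 = 6 := rfl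
    omega
  interval_cases k <;> simp [Nat.choose] at h <;> omega

lemma qs_adj (n k j : ℕ) (x y : Fin n) : (quasiStar n k j).Adj x y ↔ x.val ≠ y.val ∧
    ¬ (((x.val < k ∧ y.val < k) ∨ (x.val = k ∧ y.val < k - j)) ∨
       ((y.val < k ∧ x.val < k) ∨ (y.val = k ∧ x.val < k - j))) := by
  unfold quasiStar quasiComplete
  simp only [SimpleGraph.compl_adj, SimpleGraph.fromRel_adj, ne_eq, Fin.ext_iff]
  tauto

lemma qc_adj (n k j : ℕ) (x y : Fin n) : (quasiComplete n k j).Adj x y ↔ x.val ≠ y.val ∧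
    (((x.val < k ∧ y.val < k) ∨ (x.val = k ∧ y.val < k - j)) ∨
       ((y.val < k ∧ x.val < k) ∨ (y.val = k ∧ x.val < k - j))) := by
  unfold quasiComplete
  simp only [SimpleGraph.fromRel_adj, ne_eq, Fin.ext_iff]

lemma fin_ne {n : ℕ} {a b : ℕ} (ha : a < n) (hb : b < n) (h : a ≠ b) : (⟨a, ha⟩ : Fin n) ≠ ⟨b, hb⟩ := by
  simpa using h

lemma final_small (n t k j : ℕ) (hn : 5 ≤ n) (ht : t ≤ 3) (hj : 1 ≤ j) (hjk : j ≤ k)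
    (h : t + (k+1).choose 2 = n.choose 2 + j) :
    HOptimal t (quasiStar n k j) ∧
      ∀ G' : SimpleGraph (Fin n), HOptimal t G' → Nonempty (G' ≃g quasiStar n k j) := by
  apply small_case hn t ht
  rcases small_params n t k j hn ht hj hjk h with ⟨rfl, rfl, rfl⟩ | ⟨h1, rfl, rfl⟩
  · apply star0_of hn
    intro x y
    rw [qs_adj]
    omega
  · interval_cases j
    · apply star1_of _ ⟨k, by omega⟩ ⟨k-1, by omega⟩ (fin_ne _ _ (by omega))
      intro x y
      rw [qs_adj]; simp only [Fin.ext_iff]; omega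
    · apply star2_of _ ⟨k, by omega⟩ ⟨k-1, by omega⟩ ⟨k-2, by omega⟩ (fin_ne _ _ (by omega)) (fin_ne _ _ (by omega)) (fin_ne _ _ (by omega))
      intro x y
      rw [qs_adj]; simp only [Fin.ext_iff]; omega
    · apply star3_of _ ⟨k, by omega⟩ ⟨k-1, by omega⟩ ⟨k-2, by omega⟩ ⟨k-3, by omega⟩ (fin_ne _ _ (by omega)) (fin_ne _ _ (by omega)) (fin_ne _ _ (by omega)) (fin_ne _ _ (by omega)) (fin_ne _ _ (by omega)) (fin_ne _ _ (by omega))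
      intro x y
      rw [qs_adj]; simp only [Fin.ext_iff]; omega

lemma final_large (n m t k j : ℕ) (hn : 5 ≤ n) (ht : t ≤ 3) (hm : m + t = n.choose 2) (hj : 1 ≤ j) (hjk : j ≤ k)
    (h : m + (k+1).choose 2 = n.choose 2 + j) :
    HOptimal m (quasiStar n k j) ∧
      ∀ G' : SimpleGraph (Fin n), HOptimal m G' → Nonempty (G' ≃g quasiStar n k j) := by
  unfold quasiStar
  apply large_case hn t m ht hm
  rcases large_params n m t k j ht hm hj hjk h with ⟨rfl, rfl, rfl⟩ | ⟨rfl, rfl, rfl⟩ | ⟨rfl, rfl, rfl⟩ | ⟨rfl, rfl, rfl⟩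
  · refine Or.inl ⟨by norm_num, ?_⟩
    apply star0_of hn
    intro x y
    rw [qc_adj]; omega
  · refine Or.inl ⟨by norm_num, ?_⟩
    apply star1_of _ ⟨0, by omega⟩ ⟨1, by omega⟩ (fin_ne _ _ (by omega))
    intro x y
    rw [qc_adj]; simp only [Fin.ext_iff]; omega
  · refine Or.inl ⟨by norm_num, ?_⟩
    apply star2_of _ ⟨0, by omega⟩ ⟨1, by omega⟩ ⟨2, by omega⟩ (fin_ne _ _ (by omega)) (fin_ne _ _ (by omega)) (fin_ne _ _ (by omega))
    intro x y
    rw [qc_adj]; simp only [Fin.ext_iff]; omega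
  · refine Or.inr ⟨rfl, ?_⟩
    apply tri_of _ ⟨0, by omega⟩ ⟨1, by omega⟩ ⟨2, by omega⟩ (fin_ne _ _ (by omega)) (fin_ne _ _ (by omega)) (fin_ne _ _ (by omega))
    intro x y
    rw [qc_adj]; simp only [Fin.ext_iff]; omega

theorem stmt10 (n m k' j' : ℕ) (hn : 5 ≤ n) (hm : m ≤ n.choose 2)
    (hmem : m = 0 ∨ m = 1 ∨ m = 2 ∨ m = 3 ∨ m = n.choose 2 - 3 ∨ m = n.choose 2 - 2 ∨
      m = n.choose 2 - 1 ∨ m = n.choose 2)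
    (hj' : 1 ≤ j') (hjk' : j' ≤ k') (hkj' : m + (k'+1).choose 2 = n.choose 2 + j') :
    HOptimal m (quasiStar n k' j') ∧
      ∀ G' : SimpleGraph (Fin n), HOptimal m G' → Nonempty (G' ≃g quasiStar n k' j') := by
  have hc : 10 ≤ n.choose 2 := choose_step 5 n hn
  rcases hmem with h | h | h | h | h | h | h | h
  · exact final_small n m k' j' hn (by omega) hj' hjk' hkj'
  · exact final_small n m k' j' hn (by omega) hj' hjk' hkj'
  · exact final_small n m k' j' hn (by omega) hj' hjk' hkj'
  · exact final_small n m k' j' hn (by omega) hj' hjk' hkj'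
  · exact final_large n m 3 k' j' hn (by omega) (by omega) hj' hjk' hkj'
  · exact final_large n m 2 k' j' hn (by omega) (by omega) hj' hjk' hkj'
  · exact final_large n m 1 k' j' hn (by omega) (by omega) hj' hjk' hkj'
  · exact final_large n m 0 k' j' hn (by omega) (by omega) hj' hjk' hkj'
end
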